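/- A finitely generated residually finite group Γ is uniformly HS stable if and only if Γ is virtually abelian (i.e., Γ has an abelian subgroup of finite index). -/

import Mathlib

open scoped Matrix

/-- Normalized Hilbert–Schmidt norm: ‖A‖_{HS,n} = ((1/n)·Tr(A Aᴴ))^{1/2}. -/
noncomputable def hsNorm {n m : ℕ} (A : Matrix (Fin n) (Fin m) ℂ) : ℝ :=
  Real.sqrt ((1 / (n : ℝ)) * (Matrix.trace (A * Aᴴ)).re)

/-- Operator norm (largest singular value) of a rectangular complex matrix. -/
noncomputable def opNorm {n m : ℕ} (A : Matrix (Fin n) (Fin m) ℂ) : ℝ :=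
  ‖LinearMap.toContinuousLinearMap (Matrix.toEuclideanLin A)‖

/-- Γ is uniformly HS stable: for every δ>0 there is ε>0 such that every
ε-homomorphism into some U(n) (w.r.t. the normalized HS metric) is δ-close to a
genuine unitary representation of the same dimension. -/
def UniformlyHSStable (Γ : Type*) [Group Γ] : Prop :=
  ∀ δ : ℝ, 0 < δ → ∃ ε : ℝ, 0 < ε ∧
    ∀ (n : ℕ) (φ : Γ → Matrix.unitaryGroup (Fin n) ℂ),
      (∀ g h : Γ, hsNorm ((φ g : Matrix (Fin n) (Fin n) ℂ) * (φ h : Matrix (Fin n) (Fin n) ℂ)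
        - (φ (g * h) : Matrix (Fin n) (Fin n) ℂ)) < ε) →
      ∃ π : Γ →* Matrix.unitaryGroup (Fin n) ℂ,
        ∀ g : Γ, hsNorm ((φ g : Matrix (Fin n) (Fin n) ℂ) - (π g : Matrix (Fin n) (Fin n) ℂ)) < δ

/-- A unitary representation is irreducible if ℂⁿ has no nonzero proper invariant subspace. -/
def IsIrreducibleRep {Γ : Type*} [Group Γ] {n : ℕ}
    (π : Γ →* Matrix.unitaryGroup (Fin n) ℂ) : Prop :=
  ∀ W : Submodule ℂ (Fin n → ℂ),
    (∀ g : Γ, ∀ v ∈ W, Matrix.mulVec (π g : Matrix (Fin n) (Fin n) ℂ) v ∈ W) →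
    W = ⊥ ∨ W = ⊤

/-- Residual finiteness: every nonidentity element avoids some finite index normal subgroup. -/
def ResiduallyFinite (Γ : Type*) [Group Γ] : Prop :=
  ∀ x : Γ, x ≠ 1 → ∃ N : Subgroup Γ, N.Normal ∧ N.FiniteIndex ∧ x ∉ N

/-- Virtually abelian: there is an abelian subgroup of finite index. -/
def VirtuallyAbelian (Γ : Type*) [Group Γ] : Prop :=
  ∃ A : Subgroup Γ, A.FiniteIndex ∧ ∀ x ∈ A, ∀ y ∈ A, x * y = y * x

/-- Amenability: a finitely additive, left-invariant probability measure on all subsets. -/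
def IsAmenable (Γ : Type*) [Group Γ] : Prop :=
  ∃ μ : Set Γ → ℝ,
    (∀ S : Set Γ, 0 ≤ μ S) ∧
    μ Set.univ = 1 ∧
    (∀ S T : Set Γ, Disjoint S T → μ (S ∪ T) = μ S + μ T) ∧
    (∀ (g : Γ) (S : Set Γ), μ ((fun x => g * x) '' S) = μ S)

section

open scoped InnerProductSpace commutatorElement ComplexConjugate

/-- The standard Hermitian space of dimension `n`. -/
abbrev Cn (n : ℕ) := EuclideanSpace ℂ (Fin n)

section HilbertSchmidt

variable {E F : Type*} [NormedAddCommGroup E] [InnerProductSpace ℂ E]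
  [NormedAddCommGroup F] [InnerProductSpace ℂ F] {k : ℕ}

/-- The images of the standard basis vectors, as a point of the `ℓ²`-sum of copies of `E`. -/
noncomputable def hsVec (A : Cn k →L[ℂ] E) : PiLp 2 (fun _ : Fin k => E) :=
  WithLp.toLp 2 fun j => A (EuclideanSpace.single j 1)

/-- The (unnormalized) Hilbert–Schmidt norm. -/
noncomputable def hs (A : Cn k →L[ℂ] E) : ℝ := ‖hsVec A‖

lemma hs_nonneg (A : Cn k →L[ℂ] E) : 0 ≤ hs A := norm_nonneg _

lemma hs_sq (A : Cn k →L[ℂ] E) : hs A ^ 2 = ∑ j, ‖A (EuclideanSpace.single j 1)‖ ^ 2 := by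
  simp [hs, hsVec, PiLp.norm_sq_eq_of_L2]

lemma hsVec_add (A B : Cn k →L[ℂ] E) : hsVec (A + B) = hsVec A + hsVec B := by
  ext j; simp [hsVec]

lemma hsVec_sub (A B : Cn k →L[ℂ] E) : hsVec (A - B) = hsVec A - hsVec B := by
  ext j; simp [hsVec]

lemma hs_add_le (A B : Cn k →L[ℂ] E) : hs (A + B) ≤ hs A + hs B := by
  simpa [hs, hsVec_add] using norm_add_le (hsVec A) (hsVec B)

lemma hs_sub_comm (A B : Cn k →L[ℂ] E) : hs (A - B) = hs (B - A) := by
  simpa [hs, hsVec_sub] using norm_sub_rev (hsVec A) (hsVec B)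

lemma hs_sub_le (A B C : Cn k →L[ℂ] E) : hs (A - C) ≤ hs (A - B) + hs (B - C) := by
  simpa using hs_add_le (A - B) (B - C)

lemma hs_comp_left_le {C : ℝ} (hC : 0 ≤ C) (B : E →L[ℂ] F) (hB : ∀ v, ‖B v‖ ≤ C * ‖v‖)
    (A : Cn k →L[ℂ] E) : hs (B ∘L A) ≤ C * hs A := by
  refine le_of_sq_le_sq ?_ (mul_nonneg hC (hs_nonneg A))
  rw [mul_pow, hs_sq, hs_sq, Finset.mul_sum]
  refine Finset.sum_le_sum fun j _ => ?_
  rw [← mul_pow]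
  exact pow_le_pow_left₀ (norm_nonneg _) (hB _) 2

lemma hs_comp_left_of_isometric (B : E →L[ℂ] F) (hB : ∀ v, ‖B v‖ = ‖v‖)
    (A : Cn k →L[ℂ] E) : hs (B ∘L A) = hs A := by
  rw [← sq_eq_sq₀ (hs_nonneg _) (hs_nonneg _), hs_sq, hs_sq]
  simp [hB]

lemma hs_sq_of_isometric (A : Cn k →L[ℂ] E) (hA : ∀ v, ‖A v‖ = ‖v‖) : hs A ^ 2 = k := by
  simp [hs_sq, hA]

variable [CompleteSpace E]

lemma sum_norm_sq_eq_trace {ι : Type*} [Fintype ι] (A : Cn k →L[ℂ] E)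
    (b : OrthonormalBasis ι ℂ (Cn k)) :
    ((∑ i, ‖A (b i)‖ ^ 2 : ℝ) : ℂ) = LinearMap.trace ℂ (Cn k) (A.adjoint ∘L A).toLinearMap := by
  rw [LinearMap.trace_eq_sum_inner _ b]
  push_cast
  refine Finset.sum_congr rfl fun i _ => ?_
  simp [ContinuousLinearMap.adjoint_inner_right, inner_self_eq_norm_sq_to_K]

lemma hs_sq_eq_sum {ι : Type*} [Fintype ι] (A : Cn k →L[ℂ] E) (b : OrthonormalBasis ι ℂ (Cn k)) :
    hs A ^ 2 = ∑ i, ‖A (b i)‖ ^ 2 := by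
  have h := (sum_norm_sq_eq_trace A (EuclideanSpace.basisFun (Fin k) ℂ)).trans
    (sum_norm_sq_eq_trace A b).symm
  simp only [EuclideanSpace.basisFun_apply] at h
  rw [hs_sq]
  exact_mod_cast h

lemma hs_comp_right_of_isometric (A : Cn k →L[ℂ] E) (U : Cn k →L[ℂ] Cn k)
    (hU : ∀ v, ‖U v‖ = ‖v‖) : hs (A ∘L U) = hs A := by
  let L : Cn k →ₗᵢ[ℂ] Cn k := ⟨U.toLinearMap, hU⟩
  have h := hs_sq_eq_sum A ((EuclideanSpace.basisFun (Fin k) ℂ).map (L.toLinearIsometryEquiv rfl))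
  rw [← sq_eq_sq₀ (hs_nonneg _) (hs_nonneg _), h, hs_sq]
  simp [L]

end HilbertSchmidt

section Projections

variable {E : Type*} [NormedAddCommGroup E] [InnerProductSpace ℂ E] {k : ℕ}

lemma norm_starProjection_sq (R : Submodule ℂ E) [FiniteDimensional ℂ R] {ι : Type*} [Fintype ι]
    (b : OrthonormalBasis ι ℂ R) (x : E) :
    ‖R.starProjection x‖ ^ 2 = ∑ i, ‖⟪(b i : E), x⟫_ℂ‖ ^ 2 := by
  have h := b.sum_sq_norm_inner_right (R.orthogonalProjectionOnto x)
  rw [Submodule.starProjection_apply, Submodule.norm_coe, ← h]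
  refine Finset.sum_congr rfl fun i _ => ?_
  rw [Submodule.inner_orthogonalProjectionOnto_eq_of_mem_left]

variable [CompleteSpace E]

lemma sum_norm_inner_sq_eq_adjoint (A : Cn k →L[ℂ] E) (x : E) :
    ∑ j, ‖⟪x, A (EuclideanSpace.single j 1)⟫_ℂ‖ ^ 2 = ‖A.adjoint x‖ ^ 2 := by
  have h := (EuclideanSpace.basisFun (Fin k) ℂ).sum_sq_norm_inner_left (A.adjoint x)
  rw [← h]
  simp only [EuclideanSpace.basisFun_apply, ContinuousLinearMap.adjoint_inner_left]

lemma sum_adjoint_sq_le {ι : Type*} [Fintype ι] {r : ι → E} (hr : Orthonormal ℂ r)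
    (A : Cn k →L[ℂ] E) : ∑ i, ‖A.adjoint (r i)‖ ^ 2 ≤ hs A ^ 2 := by
  simp_rw [← sum_norm_inner_sq_eq_adjoint]
  rw [Finset.sum_comm, hs_sq]
  exact Finset.sum_le_sum fun j _ => hr.sum_inner_products_le _

lemma adjoint_apply_norm_le {F : Type*} [NormedAddCommGroup F] [InnerProductSpace ℂ F]
    [CompleteSpace F] (A : F →L[ℂ] E) (hA : ∀ v, ‖A v‖ ≤ ‖v‖) (x : E) :
    ‖A.adjoint x‖ ≤ ‖x‖ := by
  have h1 : ‖A.adjoint‖ ≤ 1 := by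
    rw [LinearIsometryEquiv.norm_map]
    exact A.opNorm_le_bound zero_le_one (by simpa using hA)
  simpa using A.adjoint.le_of_opNorm_le h1 x

variable (R : Submodule ℂ E) [FiniteDimensional ℂ R]

lemma hs_starProjection_comp_sq_eq {ι : Type*} [Fintype ι] (b : OrthonormalBasis ι ℂ R)
    (A : Cn k →L[ℂ] E) :
    hs (R.starProjection ∘L A) ^ 2 = ∑ i, ‖A.adjoint (b i)‖ ^ 2 := by
  rw [hs_sq]
  simp only [ContinuousLinearMap.comp_apply, norm_starProjection_sq R b]
  rw [Finset.sum_comm]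
  simp_rw [sum_norm_inner_sq_eq_adjoint]

lemma hs_starProjection_comp_sq_le (A : Cn k →L[ℂ] E) (hA : ∀ v, ‖A v‖ ≤ ‖v‖) :
    hs (R.starProjection ∘L A) ^ 2 ≤ Module.finrank ℂ R := by
  rw [hs_starProjection_comp_sq_eq R (stdOrthonormalBasis ℂ R)]
  calc _ ≤ ∑ i : Fin (Module.finrank ℂ R), (1 : ℝ) := Finset.sum_le_sum fun i _ => ?_
    _ = _ := by simp
  have h : ‖((stdOrthonormalBasis ℂ R i : R) : E)‖ = 1 := by
    rw [Submodule.norm_coe]; exact (stdOrthonormalBasis ℂ R).orthonormal.1 i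
  have := adjoint_apply_norm_le A hA (stdOrthonormalBasis ℂ R i : E)
  rw [h] at this
  exact pow_le_one₀ (norm_nonneg _) this

/-- A contraction of `ℂᵏ` is close to a unitary, in terms of its Hilbert–Schmidt defect. -/
theorem exists_isometry_near_contraction (X : Cn k →L[ℂ] Cn k) (hX : ∀ v, ‖X v‖ ≤ ‖v‖) :
    ∃ U : Cn k ≃ₗᵢ[ℂ] Cn k, hs (X - (U : Cn k →L[ℂ] Cn k)) ^ 2 ≤ k - hs X ^ 2 := by
  have hT : (X.adjoint ∘L X).toLinearMap.IsSymmetric := fun x y => by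
    simp [ContinuousLinearMap.adjoint_inner_left, ContinuousLinearMap.adjoint_inner_right]
  have hk : Module.finrank ℂ (Cn k) = k := by simp
  let q := hT.eigenvectorBasis hk
  have horth : ∀ i j, i ≠ j → ⟪X (q i), X (q j)⟫_ℂ = 0 := fun i j hij => by
    rw [← ContinuousLinearMap.adjoint_inner_right]
    have h := hT.apply_eigenvectorBasis hk j
    simp only [ContinuousLinearMap.coe_coe, ContinuousLinearMap.comp_apply] at h
    rw [h, inner_smul_right, q.orthonormal.2 hij, mul_zero]
  let v : Fin k → Cn k := fun i => ((‖X (q i)‖⁻¹ : ℝ) : ℂ) • X (q i)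
  have hv : Orthonormal ℂ (Set.domRestrict {i | X (q i) ≠ 0} v) := by
    refine ⟨fun i => ?_, fun i j hij => ?_⟩
    · have : ‖X (q i)‖ ≠ 0 := norm_ne_zero_iff.2 i.2
      simp [Set.domRestrict, v, norm_smul, this]
    · simp [Set.domRestrict, v, inner_smul_left, inner_smul_right,
        horth i j (fun h => hij (Subtype.ext h))]
  obtain ⟨b, hb⟩ := hv.exists_orthonormalBasis_extension_of_card_eq (by simp)
  refine ⟨q.equiv b (Equiv.refl _), ?_⟩
  rw [hs_sq_eq_sum _ q, hs_sq_eq_sum X q]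
  calc _ ≤ ∑ i : Fin k, (1 - ‖X (q i)‖ ^ 2) := Finset.sum_le_sum fun i _ => ?_
    _ = _ := by simp
  have hU : (q.equiv b (Equiv.refl _)) (q i) = b i := by simp
  have ht : ‖X (q i)‖ ≤ 1 := by simpa using hX (q i)
  by_cases hi : X (q i) = 0
  · simp [hi]
  · have h2 : X (q i) - b i = ((‖X (q i)‖ - 1 : ℝ) : ℂ) • b i := by
      rw [hb i hi]
      have : ((‖X (q i)‖ : ℝ) : ℂ) ≠ 0 := by simpa using hi
      simp only [v, smul_smul, Complex.ofReal_sub, sub_mul, sub_smul, Complex.ofReal_inv]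
      simp [this]
    have h3 : ‖(X - ((q.equiv b (Equiv.refl _) : Cn k ≃ₗᵢ[ℂ] Cn k) : Cn k →L[ℂ] Cn k)) (q i)‖
        = 1 - ‖X (q i)‖ := by
      have : (X - ((q.equiv b (Equiv.refl _) : Cn k ≃ₗᵢ[ℂ] Cn k) : Cn k →L[ℂ] Cn k)) (q i)
        = X (q i) - b i := by simp
      rw [this, h2, norm_smul, b.orthonormal.1, mul_one, Complex.norm_real, Real.norm_eq_abs,
        abs_sub_comm, abs_of_nonneg (by linarith)]
    rw [h3]
    nlinarith [norm_nonneg (X (q i))]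

end Projections

section Translation

lemma hsNorm_eq_hs_div {n : ℕ} (A : Matrix (Fin n) (Fin n) ℂ) :
    hsNorm A = hs (Matrix.toEuclideanCLM (𝕜 := ℂ) A) / √n := by
  have h : (Matrix.trace (A * Aᴴ)).re = hs (Matrix.toEuclideanCLM (𝕜 := ℂ) A) ^ 2 := by
    rw [hs_sq, Matrix.trace_mul_comm]
    simp only [Matrix.trace, Matrix.diag, Matrix.mul_apply, Complex.re_sum,
      Matrix.conjTranspose_apply]
    refine Finset.sum_congr rfl fun j _ => ?_
    rw [EuclideanSpace.norm_sq_eq]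
    refine Finset.sum_congr rfl fun i _ => ?_
    have : (Matrix.toEuclideanCLM (𝕜 := ℂ) A (EuclideanSpace.single j 1)) i = A i j := by
      simp [Matrix.ofLp_toEuclideanCLM]
    rw [this, mul_comm, ← Complex.normSq_eq_norm_sq]
    simp [Complex.normSq_apply]
  rw [hsNorm, h, Real.sqrt_mul (by positivity), Real.sqrt_sq (hs_nonneg _)]
  simp [div_eq_inv_mul]

lemma mem_unitaryGroup_iff_isometric {n : ℕ} (M : Matrix (Fin n) (Fin n) ℂ) :
    M ∈ Matrix.unitaryGroup (Fin n) ℂ ↔ ∀ v, ‖Matrix.toEuclideanCLM (𝕜 := ℂ) M v‖ = ‖v‖ := by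
  rw [Matrix.mem_unitaryGroup_iff', ContinuousLinearMap.norm_map_iff_adjoint_comp_self,
    ← ContinuousLinearMap.star_eq_adjoint, ← map_star, ← ContinuousLinearMap.mul_def, ← map_mul,
    map_eq_one_iff _ (EquivLike.injective _)]

lemma exists_unitaryGroup_hom {Γ : Type*} [Group Γ] {n : ℕ} (π : Γ →* (Cn n →L[ℂ] Cn n))
    (hπ : ∀ g v, ‖π g v‖ = ‖v‖) : ∃ ρ : Γ →* Matrix.unitaryGroup (Fin n) ℂ,
      ∀ g, Matrix.toEuclideanCLM (𝕜 := ℂ) (ρ g : Matrix (Fin n) (Fin n) ℂ) = π g := by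
  have hmem : ∀ g, (Matrix.toEuclideanCLM (𝕜 := ℂ) (n := Fin n)).symm (π g) ∈
      Matrix.unitaryGroup (Fin n) ℂ := fun g =>
    (mem_unitaryGroup_iff_isometric _).2 (by simpa using hπ g)
  refine ⟨{ toFun := fun g => ⟨_, hmem g⟩, map_one' := ?_, map_mul' := fun a b => ?_ },
    fun g => ?_⟩
  · ext1
    simp only [map_one, OneMemClass.coe_one]
  · ext1
    simp only [map_mul, Submonoid.coe_mul]
  · simp only [MonoidHom.coe_mk, OneHom.coe_mk, StarAlgEquiv.apply_symm_apply]

/-- Uniform HS stability, phrased with isometric operators of `ℂⁿ`. -/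
def OpStable (Γ : Type*) [Group Γ] : Prop :=
  ∀ δ : ℝ, 0 < δ → ∃ ε : ℝ, 0 < ε ∧
    ∀ (n : ℕ) (φ : Γ → Cn n →L[ℂ] Cn n), (∀ g v, ‖φ g v‖ = ‖v‖) →
      (∀ g h, hs (φ g ∘L φ h - φ (g * h)) ≤ ε * √n) →
      ∃ π : Γ →* (Cn n →L[ℂ] Cn n), (∀ g v, ‖π g v‖ = ‖v‖) ∧ ∀ g, hs (φ g - π g) ≤ δ * √n

lemma hs_eq_zero_of_dim_zero {E : Type*} [NormedAddCommGroup E] [InnerProductSpace ℂ E]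
    (A : Cn 0 →L[ℂ] E) : hs A = 0 := by
  have := hs_sq A
  simpa using this

theorem uniformlyHSStable_iff_opStable (Γ : Type*) [Group Γ] :
    UniformlyHSStable Γ ↔ OpStable Γ := by
  constructor
  · intro H δ hδ
    obtain ⟨ε, hε, H⟩ := H δ hδ
    refine ⟨ε / 2, by positivity, fun n φ hφ hd => ?_⟩
    let ψ : Γ → Matrix.unitaryGroup (Fin n) ℂ := fun g =>
      ⟨(Matrix.toEuclideanCLM (𝕜 := ℂ) (n := Fin n)).symm (φ g),
        (mem_unitaryGroup_iff_isometric _).2 (by simpa using hφ g)⟩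
    have hψ : ∀ g, Matrix.toEuclideanCLM (𝕜 := ℂ) (ψ g : Matrix (Fin n) (Fin n) ℂ) = φ g :=
      fun g => by simp [ψ]
    obtain ⟨π, hπ⟩ := H n ψ fun g h => by
      rw [hsNorm_eq_hs_div, map_sub, map_mul, hψ, hψ, hψ]
      refine lt_of_le_of_lt ?_ (half_lt_self hε)
      exact div_le_of_le_mul₀ (by positivity) (by positivity) (hd g h)
    refine ⟨((Matrix.toEuclideanCLM (𝕜 := ℂ) (n := Fin n) : _ →* _).comp
      (Submonoid.subtype _)).comp π, fun g => ?_, fun g => ?_⟩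
    · exact (mem_unitaryGroup_iff_isometric _).1 (π g).2
    · have := (hπ g).le
      rw [hsNorm_eq_hs_div, map_sub, hψ] at this
      rcases Nat.eq_zero_or_pos n with rfl | hn
      · simp [hs_eq_zero_of_dim_zero]
      · exact (div_le_iff₀ (by positivity)).1 this
  · intro H δ hδ
    obtain ⟨ε, hε, H⟩ := H (δ / 2) (by positivity)
    refine ⟨ε, hε, fun n φ hd => ?_⟩
    obtain ⟨π, hπ, hφπ⟩ := H n (fun g => Matrix.toEuclideanCLM (𝕜 := ℂ) (φ g : Matrix _ _ ℂ))
      (fun g => (mem_unitaryGroup_iff_isometric _).1 (φ g).2) fun g h => by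
        have := (hd g h).le
        rw [hsNorm_eq_hs_div, map_sub, map_mul] at this
        rcases Nat.eq_zero_or_pos n with rfl | hn
        · simp [hs_eq_zero_of_dim_zero]
        · exact (div_le_iff₀ (by positivity)).1 this
    obtain ⟨ρ, hρ⟩ := exists_unitaryGroup_hom π hπ
    refine ⟨ρ, fun g => ?_⟩
    rw [hsNorm_eq_hs_div, map_sub, hρ]
    refine lt_of_le_of_lt ?_ (half_lt_self hδ)
    refine div_le_of_le_mul₀ (by positivity) (by positivity) ?_
    exact hφπ g

end Translation

section FixedPoint

/-- A group of linear isometries of a Hilbert space that moves `v` by less than `‖v‖` has a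
nonzero fixed vector. -/
theorem exists_fixed_ne_zero {G H : Type*} [Group G] [NormedAddCommGroup H] [InnerProductSpace ℝ H]
    [CompleteSpace H] (T : G → H →ₗ[ℝ] H) (hT : ∀ g v, ‖T g v‖ = ‖v‖)
    (hmul : ∀ g h v, T g (T h v) = T (g * h) v) (v : H) {c : ℝ} (hc : c < ‖v‖)
    (h : ∀ g, ‖T g v - v‖ ≤ c) : ∃ w, w ≠ 0 ∧ ∀ g, T g w = w := by
  set S : Set H := Set.range fun g => T g v
  set C : Set H := closure (convexHull ℝ S)
  have hne : C.Nonempty := ⟨T 1 v, subset_closure (subset_convexHull ℝ S ⟨1, rfl⟩)⟩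
  have hconv : Convex ℝ C := (convex_convexHull ℝ S).closure
  obtain ⟨w, hwC, hw⟩ := exists_norm_eq_iInf_of_complete_convex hne
    isClosed_closure.isComplete hconv 0
  have hmin := (norm_eq_iInf_iff_real_inner_le_zero hconv hwC).1 hw
  have hmaps : ∀ g, T g w ∈ C := fun g => by
    have hcont : Continuous (T g) :=
      ((T g).mkContinuous 1 fun x => by rw [hT, one_mul]).continuous
    have h1 : T g w ∈ closure (T g '' convexHull ℝ S) :=
      image_closure_subset_closure_image hcont ⟨w, hwC, rfl⟩
    rw [(T g).image_convexHull] at h1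
    refine closure_mono (convexHull_mono ?_) h1
    rintro _ ⟨_, ⟨x, rfl⟩, rfl⟩
    exact ⟨g * x, (hmul g x v).symm⟩
  have hball : C ⊆ Metric.closedBall v c := by
    refine closure_minimal (convexHull_min ?_ (convex_closedBall v c)) Metric.isClosed_closedBall
    rintro _ ⟨g, rfl⟩
    simpa [dist_eq_norm] using h g
  refine ⟨w, ?_, fun g => ?_⟩
  · rintro rfl
    have := hball hwC
    rw [mem_closedBall_iff_norm, zero_sub, norm_neg] at this
    linarith
  · have h1 := hmin _ (hmaps g)
    rw [zero_sub, inner_neg_left, inner_sub_right, real_inner_self_eq_norm_sq] at h1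
    have h2 := norm_sub_sq_real (T g w) w
    rw [hT, real_inner_comm] at h2
    have h3 : ‖T g w - w‖ ^ 2 ≤ 0 := by linarith
    rw [← sub_eq_zero, ← norm_eq_zero]
    exact pow_eq_zero_iff two_ne_zero |>.1 (le_antisymm h3 (by positivity))

variable {E : Type*} [NormedAddCommGroup E] [InnerProductSpace ℂ E] {k : ℕ}

/-- The operator with prescribed columns. -/
noncomputable def ofHsVec (w : PiLp 2 (fun _ : Fin k => E)) : Cn k →L[ℂ] E :=
  ∑ j, (EuclideanSpace.proj j : Cn k →L[ℂ] ℂ).smulRight (w j)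

lemma ofHsVec_single (w : PiLp 2 (fun _ : Fin k => E)) (j : Fin k) :
    ofHsVec w (EuclideanSpace.single j 1) = w j := by
  simp [ofHsVec]

lemma hsVec_ofHsVec (w : PiLp 2 (fun _ : Fin k => E)) : hsVec (ofHsVec w) = w := by
  ext j
  simp [hsVec, ofHsVec_single]

lemma ofHsVec_hsVec (A : Cn k →L[ℂ] E) : ofHsVec (hsVec A) = A := by
  refine ContinuousLinearMap.coe_injective <|
    (EuclideanSpace.basisFun (Fin k) ℂ).toBasis.ext fun j => ?_
  simp [ofHsVec_single, hsVec]

lemma ofHsVec_add (a b : PiLp 2 (fun _ : Fin k => E)) :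
    ofHsVec (a + b) = ofHsVec a + ofHsVec b := by
  rw [← ofHsVec_hsVec (ofHsVec a + ofHsVec b), hsVec_add, hsVec_ofHsVec, hsVec_ofHsVec]

lemma hsVec_smul (c : ℂ) (A : Cn k →L[ℂ] E) : hsVec (c • A) = c • hsVec A := by
  ext j
  simp [hsVec]

lemma ofHsVec_smul (c : ℂ) (a : PiLp 2 (fun _ : Fin k => E)) :
    ofHsVec (c • a) = c • ofHsVec a := by
  rw [← ofHsVec_hsVec (c • ofHsVec a), hsVec_smul, hsVec_ofHsVec]

theorem exists_intertwiner [CompleteSpace E] {Γ : Type*} [Group Γ] (π : Γ →* (E →L[ℂ] E))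
    (hπ : ∀ g v, ‖π g v‖ = ‖v‖)
    (σ : Γ →* (Cn k →L[ℂ] Cn k)) (hσ : ∀ g v, ‖σ g v‖ = ‖v‖) (ι : Cn k →L[ℂ] E) {c : ℝ}
    (hc : c < hs ι) (h : ∀ g, hs (π g ∘L ι - ι ∘L σ g) ≤ c) :
    ∃ T : Cn k →L[ℂ] E, T ≠ 0 ∧ ∀ g, π g ∘L T = T ∘L σ g := by
  let _ : InnerProductSpace ℝ (PiLp 2 (fun _ : Fin k => E)) := InnerProductSpace.rclikeToReal ℂ _
  have hinv : ∀ g, σ g⁻¹ ∘L σ g = 1 := fun g => by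
    rw [← ContinuousLinearMap.mul_def, ← map_mul, inv_mul_cancel, map_one]
  have hnorm : ∀ A : Cn k →L[ℂ] E, ‖hsVec A‖ = hs A := fun A => rfl
  have hact : ∀ (A : Cn k →L[ℂ] E) g, hs (π g ∘L A ∘L σ g⁻¹) = hs A := fun A g => by
    rw [hs_comp_left_of_isometric _ (hπ g), hs_comp_right_of_isometric _ _ (hσ g⁻¹)]
  let T : Γ → PiLp 2 (fun _ : Fin k => E) →ₗ[ℝ] PiLp 2 (fun _ : Fin k => E) := fun g =>
    { toFun := fun w => hsVec (π g ∘L ofHsVec w ∘L σ g⁻¹)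
      map_add' := fun a b => by
        rw [ofHsVec_add, ContinuousLinearMap.add_comp, ContinuousLinearMap.comp_add, hsVec_add]
      map_smul' := fun r a => by
        change hsVec (π g ∘L ofHsVec ((r : ℂ) • a) ∘L σ g⁻¹) = (r : ℂ) • hsVec _
        rw [ofHsVec_smul, ContinuousLinearMap.smul_comp, ContinuousLinearMap.comp_smul,
          hsVec_smul] }
  obtain ⟨w, hw0, hw⟩ := exists_fixed_ne_zero T (fun g v => by
      change ‖hsVec _‖ = _
      rw [hnorm, hact, ← hnorm, hsVec_ofHsVec]) (fun a b v => by
      change hsVec (_ ∘L ofHsVec (hsVec _) ∘L _) = hsVec _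
      rw [ofHsVec_hsVec, mul_inv_rev, map_mul, map_mul]
      rfl) (hsVec ι) hc fun g => by
        change ‖hsVec _ - _‖ ≤ c
        rw [ofHsVec_hsVec, ← hsVec_sub, hnorm, ← hs_comp_right_of_isometric _ (σ g) (hσ g)]
        convert h g using 2
        rw [ContinuousLinearMap.sub_comp, ContinuousLinearMap.comp_assoc,
          ContinuousLinearMap.comp_assoc, hinv]
        rfl
  refine ⟨ofHsVec w, fun h0 => hw0 ?_, fun g => ?_⟩
  · rw [← hsVec_ofHsVec w, h0]
    ext
    simp [hsVec]
  · have h1 : ofHsVec (hsVec (π g ∘L ofHsVec w ∘L σ g⁻¹)) = ofHsVec w := congrArg ofHsVec (hw g)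
    rw [ofHsVec_hsVec] at h1
    nth_rw 2 [← h1]
    rw [ContinuousLinearMap.comp_assoc, ContinuousLinearMap.comp_assoc, hinv]
    rfl

end FixedPoint

section DimensionBound

variable {Γ : Type*} [Group Γ] {E : Type*} [NormedAddCommGroup E] [InnerProductSpace ℂ E]

/-- A representation by bounded operators without proper nonzero invariant subspaces. -/
def IrreducibleOp (π : Γ →* (E →L[ℂ] E)) : Prop :=
  ∀ W : Submodule ℂ E, (∀ g, ∀ v ∈ W, π g v ∈ W) → W = ⊥ ∨ W = ⊤

lemma comp_adjoint_eq_starProjection {k : ℕ} [CompleteSpace E] (ι : Cn k →ₗᵢ[ℂ] E) :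
    ι.toContinuousLinearMap ∘L ι.toContinuousLinearMap.adjoint =
      (LinearMap.range ι.toLinearMap).starProjection := by
  ext x
  symm
  refine Submodule.eq_starProjection_of_mem_of_inner_eq_zero ⟨_, rfl⟩ ?_
  rintro _ ⟨y, rfl⟩
  have h := ContinuousLinearMap.adjoint_inner_left ι.toContinuousLinearMap y x
  have h2 := ι.inner_map_map (ι.toContinuousLinearMap.adjoint x) y
  simp only [LinearIsometry.coe_toContinuousLinearMap] at h
  simp [inner_sub_left, h2, h]

lemma exists_linearIsometry_of_le {k n : ℕ} (hkn : k ≤ n) : Nonempty (Cn k →ₗᵢ[ℂ] Cn n) := by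
  let b := EuclideanSpace.basisFun (Fin k) ℂ
  let c := EuclideanSpace.basisFun (Fin n) ℂ
  refine ⟨LinearMap.isometryOfOrthonormal
    (b.toBasis.constr ℂ fun j => c (j.castLE hkn)) (v := b.toBasis) (by simp) ?_⟩
  have : (b.toBasis.constr ℂ fun j => c (j.castLE hkn)) ∘ b.toBasis = c ∘ Fin.castLE hkn := by
    ext1 j
    simp only [Function.comp_apply, Module.Basis.constr_basis]
  rw [this]
  exact c.orthonormal.comp _ (Fin.castLE_injective hkn)

lemma hs_sq_eq_add_starProjection [CompleteSpace E] {k : ℕ} (R : Submodule ℂ E)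
    [FiniteDimensional ℂ R] (A : Cn k →L[ℂ] E) :
    hs A ^ 2 = hs (R.starProjection ∘L A) ^ 2 + hs (R.starProjection ∘L A - A) ^ 2 := by
  simp only [hs_sq, ← Finset.sum_add_distrib]
  refine Finset.sum_congr rfl fun j _ => ?_
  rw [Submodule.norm_sq_eq_add_norm_sq_starProjection _ R, Submodule.starProjection_orthogonal_val,
    norm_sub_rev]
  rfl

/-- The irreducible representations of a uniformly stable group have bounded dimension:
compressing a large one to a hyperplane gives an almost representation, and a nearby
representation would be intertwined with it. -/
theorem OpStable.exists_irreducible_dim_le (hΓ : OpStable Γ) :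
    ∃ D : ℕ, ∀ (d : ℕ) (π : Γ →* (Cn d →L[ℂ] Cn d)), (∀ g v, ‖π g v‖ = ‖v‖) →
      IrreducibleOp π → d ≤ D := by
  obtain ⟨ε, hε, H⟩ := hΓ (1 / 2) (by norm_num)
  obtain ⟨K, hK⟩ := exists_nat_ge (max ((6 / ε) ^ 2) 25)
  refine ⟨K, fun d π hπ hirr => ?_⟩
  by_contra! hd
  obtain ⟨k, rfl⟩ : ∃ k, d = k + 1 := ⟨d - 1, by omega⟩
  have hKk : (K : ℝ) ≤ k := by exact_mod_cast Nat.lt_succ_iff.1 hd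
  have hk1 : 6 ≤ ε * √k := by
    rw [← div_le_iff₀' hε]
    exact Real.le_sqrt_of_sq_le (((le_max_left _ _).trans hK).trans hKk)
  have hk2 : 5 ≤ √k := Real.le_sqrt_of_sq_le (by linarith [le_max_right ((6 / ε) ^ 2) 25])
  obtain ⟨ι'⟩ := exists_linearIsometry_of_le k.le_succ
  set ι : Cn k →L[ℂ] Cn (k + 1) := ι'.toContinuousLinearMap with hι
  have hιn : ∀ v, ‖ι v‖ = ‖v‖ := ι'.norm_map
  set R := LinearMap.range ι'.toLinearMap with hR
  have hRr : Module.finrank ℂ Rᗮ = 1 := by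
    have h1 := R.finrank_add_finrank_orthogonal
    have h2 : Module.finrank ℂ R = k := by
      rw [hR, LinearMap.finrank_range_of_inj ι'.injective, finrank_euclideanSpace_fin]
    rw [finrank_euclideanSpace_fin] at h1
    omega
  have hX : ∀ g, ∃ ψ : Cn k →L[ℂ] Cn k, (∀ v, ‖ψ v‖ = ‖v‖) ∧ hs (ι ∘L ψ - π g ∘L ι) ≤ 2 := by
    intro g
    set A := π g ∘L ι with hA
    have hAn : ∀ v, ‖A v‖ = ‖v‖ := fun v => by simp [hA, hπ, hιn]
    set X := ι.adjoint ∘L A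
    have hιX : ι ∘L X = R.starProjection ∘L A := by
      rw [← comp_adjoint_eq_starProjection, ← hι, ContinuousLinearMap.comp_assoc]
    have h1 := hs_sq_eq_add_starProjection R A
    have h2 : hs (R.starProjection ∘L A - A) ^ 2 ≤ 1 := by
      have h3 := hs_starProjection_comp_sq_le Rᗮ A fun v => (hAn v).le
      rw [hRr, Nat.cast_one] at h3
      convert h3 using 2
      rw [hs_sub_comm]
      congr 1
      ext1 v
      simp [Submodule.starProjection_orthogonal_val]
    rw [← hιX] at h1 h2
    rw [hs_sq_of_isometric A hAn, hs_comp_left_of_isometric _ hιn] at h1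
    obtain ⟨U, hU⟩ := exists_isometry_near_contraction X fun v => by
      refine (adjoint_apply_norm_le ι (fun w => (hιn w).le) _).trans (hAn v).le
    refine ⟨U, U.norm_map, ?_⟩
    refine (hs_sub_le _ (ι ∘L X) _).trans ?_
    rw [← ContinuousLinearMap.comp_sub, hs_comp_left_of_isometric _ hιn, hs_sub_comm]
    have h3 := (sq_le_one_iff₀ (hs_nonneg _)).1 (hU.trans (by linarith))
    have h4 := (sq_le_one_iff₀ (hs_nonneg _)).1 h2
    linarith
  choose ψ hψ hψι using hX
  obtain ⟨σ, hσ, hψσ⟩ := H k ψ hψ fun g h => by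
    refine le_trans ?_ hk1
    rw [← hs_comp_left_of_isometric ι hιn, ContinuousLinearMap.comp_sub]
    refine (hs_sub_le _ (π g ∘L ι ∘L ψ h) _).trans ?_
    have h1 : hs (ι ∘L ψ g ∘L ψ h - π g ∘L ι ∘L ψ h) ≤ 2 := by
      rw [← ContinuousLinearMap.comp_assoc, ← ContinuousLinearMap.comp_assoc,
        ← ContinuousLinearMap.sub_comp, hs_comp_right_of_isometric _ _ (hψ h)]
      exact hψι g
    have h2 : hs (π g ∘L ι ∘L ψ h - π g ∘L π h ∘L ι) ≤ 2 := by
      rw [← ContinuousLinearMap.comp_sub, hs_comp_left_of_isometric _ (hπ g)]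
      exact hψι h
    have h3 : hs (π g ∘L π h ∘L ι - ι ∘L ψ (g * h)) ≤ 2 := by
      rw [hs_sub_comm, ← ContinuousLinearMap.comp_assoc, ← ContinuousLinearMap.mul_def, ← map_mul]
      exact hψι (g * h)
    linarith [hs_sub_le (π g ∘L ι ∘L ψ h) (π g ∘L π h ∘L ι) (ι ∘L ψ (g * h))]
  obtain ⟨T, hT0, hT⟩ := exists_intertwiner π hπ σ hσ ι (c := 2 + 1 / 2 * √k) (by
    have : hs ι = √k := by
      rw [← hs_sq_of_isometric ι hιn, Real.sqrt_sq (hs_nonneg _)]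
    rw [this]
    linarith) fun g => by
      refine (hs_sub_le _ (ι ∘L ψ g) _).trans (add_le_add ?_ ?_)
      · rw [hs_sub_comm]
        exact hψι g
      · rw [← ContinuousLinearMap.comp_sub, hs_comp_left_of_isometric _ hιn]
        exact hψσ g
  rcases hirr (LinearMap.range T.toLinearMap) (by
    rintro g _ ⟨v, rfl⟩
    exact ⟨σ g v, (congrArg (fun A : Cn k →L[ℂ] Cn (k + 1) => A v) (hT g)).symm⟩) with h | h
  · exact hT0 (ContinuousLinearMap.coe_injective (LinearMap.range_eq_bot.1 h))
  · have h1 := LinearMap.finrank_range_le T.toLinearMap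
    rw [h, finrank_top, finrank_euclideanSpace_fin, finrank_euclideanSpace_fin] at h1
    omega

end DimensionBound

section Subrepresentations

variable {Γ : Type*} [Group Γ] {E : Type*} [NormedAddCommGroup E] [InnerProductSpace ℂ E]
  (π : Γ →* (E →L[ℂ] E))

lemma map_apply_map_inv_apply (g : Γ) (v : E) : π g (π g⁻¹ v) = v := by
  rw [← mul_apply_eq_comp, ← map_mul, mul_inv_cancel, map_one,
    one_apply_eq_self]

variable {π}

lemma inner_map_map_of_isometric (hπ : ∀ g v, ‖π g v‖ = ‖v‖) (g : Γ) (u v : E) :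
    ⟪π g u, π g v⟫_ℂ = ⟪u, v⟫_ℂ :=
  LinearIsometry.inner_map_map ⟨(π g).toLinearMap, hπ g⟩ u v

lemma inner_map_right_of_isometric (hπ : ∀ g v, ‖π g v‖ = ‖v‖) (g : Γ) (u v : E) :
    ⟪u, π g v⟫_ℂ = ⟪π g⁻¹ u, v⟫_ℂ := by
  rw [← inner_map_map_of_isometric hπ g (π g⁻¹ u), map_apply_map_inv_apply]

lemma map_mem_orthogonal (hπ : ∀ g v, ‖π g v‖ = ‖v‖) {W : Submodule ℂ E}
    (hW : ∀ g, ∀ v ∈ W, π g v ∈ W) (g : Γ) {v : E}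
    (hv : v ∈ Wᗮ) : π g v ∈ Wᗮ := by
  rw [Submodule.mem_orthogonal] at hv ⊢
  intro u hu
  rw [inner_map_right_of_isometric hπ]
  exact hv _ (hW _ _ hu)

/-- A finite-dimensional invariant subspace, as a representation on a standard space. -/
lemma exists_subrepresentation (hπ : ∀ g v, ‖π g v‖ = ‖v‖) [CompleteSpace E] (W : Submodule ℂ E)
    [FiniteDimensional ℂ W]
    (hW : ∀ g, ∀ v ∈ W, π g v ∈ W) :
    ∃ (ι : Cn (Module.finrank ℂ W) →ₗᵢ[ℂ] E)
      (σ : Γ →* (Cn (Module.finrank ℂ W) →L[ℂ] Cn (Module.finrank ℂ W))),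
      LinearMap.range ι.toLinearMap = W ∧ (∀ g v, ι (σ g v) = π g (ι v)) ∧
        ∀ g v, ‖σ g v‖ = ‖v‖ := by
  let e := (stdOrthonormalBasis ℂ W).repr
  let ι : Cn (Module.finrank ℂ W) →ₗᵢ[ℂ] E := W.subtypeₗᵢ.comp e.symm.toLinearIsometry
  have hr : LinearMap.range ι.toLinearMap = W := by
    ext v
    refine ⟨?_, fun hv => ⟨e ⟨v, hv⟩, by simp [ι]⟩⟩
    rintro ⟨w, rfl⟩
    exact (e.symm w).2
  have hmem : ∀ g v, π g (ι v) ∈ W := fun g v => hW g _ (e.symm v).2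
  let s : Γ → (Cn (Module.finrank ℂ W) →L[ℂ] Cn (Module.finrank ℂ W)) := fun g =>
    (e : W →L[ℂ] _) ∘L (π g ∘L ι.toContinuousLinearMap).codRestrict W (hmem g)
  have hs : ∀ g v, ι (s g v) = π g (ι v) := fun g v => by
    change ((e.symm (e ⟨π g (ι v), hmem g v⟩) : W) : E) = _
    rw [e.symm_apply_apply]
  refine ⟨ι, { toFun := s, map_one' := ?_, map_mul' := fun a b => ?_ }, hr, hs, fun g v => ?_⟩
  · ext1 v
    exact ι.injective (by rw [hs, map_one]; rfl)
  · ext1 v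
    exact ι.injective (by rw [hs, map_mul, mul_apply_eq_comp,
      mul_apply_eq_comp, hs, hs])
  · rw [← ι.norm_map, ← ι.norm_map v]
    exact (congrArg _ (hs g v)).trans (hπ _ _)

end Subrepresentations

section Separation

variable {Γ : Type*} [Group Γ]

/-- An element that acts nontrivially does so in some irreducible subrepresentation. -/
lemma exists_irreducible_ne_one_of_ne_one {E : Type*} [NormedAddCommGroup E]
    [InnerProductSpace ℂ E] [FiniteDimensional ℂ E] (ρ : Γ →* (E →L[ℂ] E))
    (hρ : ∀ g v, ‖ρ g v‖ = ‖v‖) (hfin : (Set.range ρ).Finite) {x : Γ} (hx : ρ x ≠ 1) :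
    ∃ (d : ℕ) (π : Γ →* (Cn d →L[ℂ] Cn d)), (∀ g v, ‖π g v‖ = ‖v‖) ∧ IrreducibleOp π ∧
      (Set.range π).Finite ∧ π x ≠ 1 := by
  have : CompleteSpace E := FiniteDimensional.complete ℂ E
  let P : Submodule ℂ E → Prop := fun W => (∀ g, ∀ v ∈ W, ρ g v ∈ W) ∧ ∃ w ∈ W, ρ x w ≠ w
  have hP : ∃ W, P W := by
    refine ⟨⊤, fun _ _ _ => trivial, ?_⟩
    by_contra! h
    exact hx (ContinuousLinearMap.ext fun v => h v trivial)
  obtain ⟨W, ⟨hW, w, hwW, hw⟩, hmin⟩ := exists_minimalFor_of_wellFoundedLT P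
    (fun W => Module.finrank ℂ W) hP
  obtain ⟨ι, σ, hι, hισ, hσ⟩ := exists_subrepresentation hρ W hW
  refine ⟨_, σ, hσ, fun U hU => ?_, ?_, fun h => ?_⟩
  · set U' := U.map ι.toLinearMap with hU'
    have hU'W : U' ≤ W := by
      rw [← hι]
      exact LinearMap.map_le_range
    have hU'inv : ∀ g, ∀ v ∈ U', ρ g v ∈ U' := by
      rintro g _ ⟨v, hv, rfl⟩
      exact ⟨σ g v, hU g v hv, hισ g v⟩
    have hmin' : ∀ V ≤ W, P V → V = W := fun V hV h =>
      Submodule.eq_of_le_of_finrank_le hV (hmin h (Submodule.finrank_mono hV))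
    by_cases h1 : ∃ u ∈ U', ρ x u ≠ u
    · right
      have h2 := hmin' U' hU'W ⟨hU'inv, h1⟩
      rw [← hι, hU', ← Submodule.map_top] at h2
      exact Submodule.map_injective_of_injective ι.injective h2
    · left
      push Not at h1
      have h2 := hmin' (U'ᗮ ⊓ W) inf_le_right
        ⟨fun g v hv => ⟨map_mem_orthogonal hρ hU'inv g hv.1, hW g v hv.2⟩,
        w - U'.starProjection w, ⟨U'.sub_starProjection_mem_orthogonal w,
          W.sub_mem hwW (hU'W (U'.starProjection_apply_mem w))⟩, fun h3 => hw ?_⟩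
      · have h3 : U' ≤ U'ᗮ := hU'W.trans (h2 ▸ inf_le_left)
        have h4 : U' = ⊥ := by
          rw [eq_bot_iff, ← U'.inf_orthogonal_eq_bot]
          exact le_inf le_rfl h3
        exact Submodule.map_injective_of_injective ι.injective (h4.trans (Submodule.map_bot _).symm)
      · rw [map_sub, h1 _ (U'.starProjection_apply_mem w)] at h3
        exact sub_left_injective h3
  · refine (hfin.image fun A =>
      ι.toContinuousLinearMap.adjoint ∘L A ∘L ι.toContinuousLinearMap).subset ?_
    rintro _ ⟨g, rfl⟩
    refine ⟨ρ g, ⟨g, rfl⟩, ?_⟩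
    ext1 v
    refine ext_inner_left ℂ fun u => ?_
    simp only [ContinuousLinearMap.comp_apply, ContinuousLinearMap.adjoint_inner_right,
      LinearIsometry.coe_toContinuousLinearMap]
    rw [← hισ, ι.inner_map_map]
  · have : w ∈ LinearMap.range ι.toLinearMap := hι.symm ▸ hwW
    obtain ⟨v, rfl⟩ := this
    refine hw ((hισ x v).symm.trans ?_)
    rw [h]
    rfl

theorem ResiduallyFinite.exists_irreducible_ne_one (hrf : ResiduallyFinite Γ) {x : Γ} (hx : x ≠ 1) :
    ∃ (d : ℕ) (π : Γ →* (Cn d →L[ℂ] Cn d)), (∀ g v, ‖π g v‖ = ‖v‖) ∧ IrreducibleOp π ∧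
      (Set.range π).Finite ∧ π x ≠ 1 := by
  obtain ⟨N, hN, hfin, hxN⟩ := hrf x hx
  classical
  let _ : Fintype (Γ ⧸ N) := Fintype.ofFinite _
  let r : Γ ⧸ N → EuclideanSpace ℂ (Γ ⧸ N) →L[ℂ] EuclideanSpace ℂ (Γ ⧸ N) := fun q =>
    (LinearIsometryEquiv.piLpCongrLeft 2 ℂ ℂ
      (Equiv.mulRight q⁻¹)).toLinearIsometry.toContinuousLinearMap
  have hr : ∀ q f p, r q f p = f (p * q) := fun q f p => by
    simp [r, LinearIsometryEquiv.piLpCongrLeft_apply, Equiv.piCongrLeft']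
  let ρ : Γ →* (EuclideanSpace ℂ (Γ ⧸ N) →L[ℂ] EuclideanSpace ℂ (Γ ⧸ N)) :=
    { toFun := fun g => r g
      map_one' := by
        ext f p
        rw [hr]
        simp
      map_mul' := fun a b => by
        ext f p
        rw [mul_apply_eq_comp, hr, hr, hr, QuotientGroup.mk_mul, mul_assoc] }
  refine exists_irreducible_ne_one_of_ne_one ρ
    (fun g v => LinearIsometryEquiv.norm_map _ _) ?_ (x := x) fun h => hxN ?_
  · refine (Set.finite_range r).subset ?_
    rintro _ ⟨g, rfl⟩
    exact ⟨g, rfl⟩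
  · have h1 : r x (EuclideanSpace.single (1 : Γ ⧸ N) (1 : ℂ)) 1 =
        (EuclideanSpace.single (1 : Γ ⧸ N) (1 : ℂ)) 1 :=
      congrArg (fun A : EuclideanSpace ℂ (Γ ⧸ N) →L[ℂ] EuclideanSpace ℂ (Γ ⧸ N) =>
        A (EuclideanSpace.single (1 : Γ ⧸ N) (1 : ℂ)) 1) h
    rw [hr] at h1
    by_contra hx'
    rw [← QuotientGroup.eq_one_iff] at hx'
    simp [hx'] at h1

end Separation

section CommonEigenvector

/-- A commuting family of endomorphisms has a common eigenvector in every nonzero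
finite-dimensional invariant subspace. -/
theorem exists_common_eigenvector {E ι : Type*} [AddCommGroup E] [Module ℂ E] (f : ι → E →ₗ[ℂ] E)
    (W : Submodule ℂ E) [FiniteDimensional ℂ W] (hW0 : W ≠ ⊥) (hW : ∀ i, ∀ v ∈ W, f i v ∈ W)
    (hcomm : ∀ i j, ∀ v ∈ W, f i (f j v) = f j (f i v)) :
    ∃ v ∈ W, v ≠ 0 ∧ ∀ i, ∃ μ : ℂ, f i v = μ • v := by
  let P : Submodule ℂ E → Prop := fun V => V ≤ W ∧ V ≠ ⊥ ∧ ∀ i, ∀ v ∈ V, f i v ∈ V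
  obtain ⟨V, ⟨hVW, hV0, hV⟩, hmin⟩ := exists_minimalFor_of_wellFoundedLT P
    (fun V => Module.finrank ℂ V) ⟨W, le_rfl, hW0, hW⟩
  have : FiniteDimensional ℂ V := Submodule.finiteDimensional_of_le hVW
  obtain ⟨v, hvV, hv0⟩ := V.exists_mem_ne_zero_of_ne_bot hV0
  refine ⟨v, hVW hvV, hv0, fun i => ?_⟩
  have : Nontrivial V := V.nontrivial_iff_ne_bot.2 hV0
  obtain ⟨μ, hμ⟩ := Module.End.exists_eigenvalue ((f i).restrict (hV i))
  obtain ⟨u, hu⟩ := hμ.exists_hasEigenvector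
  have hu1 : f i u = μ • (u : E) := congrArg Subtype.val hu.apply_eq_smul
  let K : Submodule ℂ E := V ⊓ LinearMap.ker (f i - μ • LinearMap.id)
  have hKmem : ∀ w, w ∈ K ↔ w ∈ V ∧ f i w = μ • w := fun w => by
    simp [K, sub_eq_zero]
  have hKV : K = V := by
    have hle : K ≤ V := inf_le_left
    refine Submodule.eq_of_le_of_finrank_le hle (hmin ⟨hle.trans hVW, ?_, fun j w hw => ?_⟩
      (Submodule.finrank_mono hle))
    · exact (Submodule.ne_bot_iff _).2 ⟨u, (hKmem _).2 ⟨u.2, hu1⟩, fun h => hu.2 (Subtype.ext h)⟩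
    · rw [hKmem] at hw ⊢
      refine ⟨hV j w hw.1, ?_⟩
      rw [hcomm i j w (hVW hw.1), hw.2, map_smul]
  exact ⟨μ, ((hKmem v).1 (hKV.symm ▸ hvV)).2⟩

end CommonEigenvector

section Jordan

lemma commute_map_inv_right {Γ M : Type*} [Group Γ] [Monoid M] (π : Γ →* M) {m : M} {x : Γ}
    (h : Commute m (π x)) : Commute m (π x⁻¹) := by
  have := h.units_inv_right (u := Units.map π (toUnits x))
  rwa [← map_inv, ← map_inv] at this

variable {Γ : Type*} [Group Γ] {E : Type*} [NormedAddCommGroup E] [InnerProductSpace ℂ E]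
  {π : Γ →* (E →L[ℂ] E)}

lemma norm_eigenvalue_eq_one (hπ : ∀ g v, ‖π g v‖ = ‖v‖) {g : Γ} {v : E} (hv : v ≠ 0) {μ : ℂ}
    (h : π g v = μ • v) :
    ‖μ‖ = 1 := by
  have h1 := hπ g v
  rw [h, norm_smul] at h1
  exact mul_right_cancel₀ (norm_ne_zero_iff.2 hv) (h1.trans (one_mul _).symm)

lemma map_inv_apply_eigenvector (hπ : ∀ g v, ‖π g v‖ = ‖v‖) {g : Γ} {v : E} (hv : v ≠ 0) {μ : ℂ}
    (h : π g v = μ • v) :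
    π g⁻¹ v = μ⁻¹ • v := by
  have hμ : μ ≠ 0 := norm_ne_zero_iff.1 (by rw [norm_eigenvalue_eq_one hπ hv h]; exact one_ne_zero)
  have h1 : π g⁻¹ (π g v) = v := by
    simpa using map_apply_map_inv_apply π g⁻¹ v
  rw [h, map_smul] at h1
  nth_rw 2 [← h1]
  rw [smul_smul, inv_mul_cancel₀ hμ, one_smul]

lemma inner_eq_zero_of_eigenvalue_ne (hπ : ∀ g v, ‖π g v‖ = ‖v‖) {g : Γ} {v w : E} (hv : v ≠ 0)
    {μ ν : ℂ}
    (hvμ : π g v = μ • v) (hwν : π g w = ν • w) (hne : μ ≠ ν) : ⟪v, w⟫_ℂ = 0 := by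
  have h := inner_map_right_of_isometric hπ g v w
  rw [hwν, map_inv_apply_eigenvector hπ hv hvμ, inner_smul_right, inner_smul_left, map_inv₀,
    ← Complex.inv_eq_conj (norm_eigenvalue_eq_one hπ hv hvμ), inv_inv] at h
  by_contra h0
  exact hne (mul_right_cancel₀ h0 h).symm

/-- Frobenius: if `h` is close to `1` and `g` commutes with its conjugate by `h`, then `g`
commutes with `h`. -/
lemma commute_of_commute_conj (hπ : ∀ g v, ‖π g v‖ = ‖v‖) [FiniteDimensional ℂ E] {g h : Γ}
    (hh : ‖π h - 1‖ < 1) (hc : Commute (π g) (π (h * g * h⁻¹))) : Commute (π g) (π h) := by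
  set c := h * g * h⁻¹ with hcdef
  suffices hgc : π g = π c by
    have : π g * π h = π c * π h := by rw [← hgc]
    rw [Commute, SemiconjBy, this, ← map_mul, ← map_mul, hcdef, inv_mul_cancel_right]
  by_contra hne
  have hcomm : ∀ v, π g (π c v) = π c (π g v) := fun v =>
    congrArg (fun A : E →L[ℂ] E => A v) hc
  let W := LinearMap.range (π g - π c).toLinearMap
  have hW0 : W ≠ ⊥ := fun h0 =>
    hne (sub_eq_zero.1 (ContinuousLinearMap.coe_injective (LinearMap.range_eq_bot.1 h0)))
  obtain ⟨v, ⟨u, hu⟩, hv0, hv⟩ := exists_common_eigenvector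
    (fun b : Bool => (π (if b then g else c)).toLinearMap) W hW0 (by
      rintro b _ ⟨u, rfl⟩
      refine ⟨π (if b then g else c) u, ?_⟩
      cases b <;> simp [hcomm]) (by
      rintro (_ | _) (_ | _) v - <;> simp [hcomm])
  obtain ⟨μ, hμ⟩ := hv true
  obtain ⟨ν, hν⟩ := hv false
  simp only [if_true, Bool.false_eq_true, if_false, ContinuousLinearMap.coe_coe] at hμ hν hu
  have hμν : μ ≠ ν := by
    rintro rfl
    have h1 : ⟪v, π g u - π c u⟫_ℂ = 0 := by
      rw [inner_sub_right, inner_map_right_of_isometric hπ, inner_map_right_of_isometric hπ,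
        map_inv_apply_eigenvector hπ hv0 hμ, map_inv_apply_eigenvector hπ hv0 hν, sub_self]
    have h2 : π g u - π c u = v := hu
    rw [h2, inner_self_eq_zero] at h1
    exact hv0 h1
  have hw : π g (π h⁻¹ v) = ν • π h⁻¹ v := by
    rw [← map_smul, ← hν, ← mul_apply_eq_comp, ← mul_apply_eq_comp, ← map_mul, ← map_mul, hcdef,
      ← mul_assoc, ← mul_assoc, inv_mul_cancel, one_mul]
  have h0 := inner_eq_zero_of_eigenvalue_ne hπ hv0 hμ hw hμν
  have h1 : ‖(π h - 1) (π h⁻¹ v)‖ ^ 2 = 2 * ‖v‖ ^ 2 := by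
    have : (π h - 1) (π h⁻¹ v) = v - π h⁻¹ v := by
      simp [map_apply_map_inv_apply]
    rw [this, @norm_sub_sq ℂ, h0, hπ]
    simp
    ring
  have h2 := (π h - 1).le_of_opNorm_le hh.le (π h⁻¹ v)
  rw [hπ, one_mul] at h2
  have h3 := norm_pos_iff.2 hv0
  nlinarith [norm_nonneg ((π h - 1) (π h⁻¹ v))]

lemma norm_map_le_one (hπ : ∀ g v, ‖π g v‖ = ‖v‖) (g : Γ) : ‖π g‖ ≤ 1 :=
  ContinuousLinearMap.opNorm_le_bound _ zero_le_one fun v => by rw [hπ, one_mul]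

lemma norm_map_commutator_sub_one_le (hπ : ∀ g v, ‖π g v‖ = ‖v‖) (x y : Γ) :
    ‖π ⁅x, y⁆ - 1‖ ≤ 2 * ‖π x - 1‖ * ‖π y - 1‖ := by
  have h : π ⁅x, y⁆ - 1 = ((π x - 1) * (π y - 1) - (π y - 1) * (π x - 1)) * π (x⁻¹ * y⁻¹) := by
    have h1 : (π x - 1) * (π y - 1) - (π y - 1) * (π x - 1) = π x * π y - π y * π x := by
      noncomm_ring
    rw [h1, sub_mul, ← map_mul, ← map_mul, ← map_mul, ← map_mul, commutatorElement_def,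
      ← mul_assoc, ← mul_assoc, mul_inv_cancel_right, mul_inv_cancel, map_one]
  rw [h]
  refine (norm_mul_le _ _).trans ((mul_le_of_le_one_right (norm_nonneg _)
    (norm_map_le_one hπ _)).trans ?_)
  refine (norm_sub_le _ _).trans ?_
  linarith [norm_mul_le (π x - 1) (π y - 1), norm_mul_le (π y - 1) (π x - 1)]

lemma norm_map_sub_map (hπ : ∀ g v, ‖π g v‖ = ‖v‖) (a b : Γ) : ‖π (a⁻¹ * b) - 1‖ ≤ ‖π a - π b‖ := by
  have h : π (a⁻¹ * b) - 1 = π a⁻¹ * (π b - π a) := by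
    rw [mul_sub, ← map_mul, ← map_mul, inv_mul_cancel, map_one]
  rw [h, norm_sub_rev (π a)]
  exact (norm_mul_le _ _).trans (mul_le_of_le_one_left (norm_nonneg _) (norm_map_le_one hπ _))

lemma commute_of_near_one (hπ : ∀ g v, ‖π g v‖ = ‖v‖) [FiniteDimensional ℂ E]
    (hfin : (Set.range π).Finite) {x y : Γ}
    (hx : ‖π x - 1‖ < 1 / 2) (hy : ‖π y - 1‖ < 1 / 2) : Commute (π x) (π y) := by
  let s : ℕ → Γ := fun k => (fun z => ⁅x, z⁆)^[k] y
  have hs : ∀ k, s (k + 1) = ⁅x, s k⁆ := fun k => Function.iterate_succ_apply' _ _ _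
  have hbound : ∀ k, ‖π (s k) - 1‖ ≤ (2 * ‖π x - 1‖) ^ k * (1 / 2) := by
    intro k
    induction k with
    | zero => simpa [s] using hy.le
    | succ k ih =>
      rw [hs, pow_succ', mul_assoc]
      exact (norm_map_commutator_sub_one_le hπ _ _).trans (by gcongr)
  have hlt : 2 * ‖π x - 1‖ < 1 := by linarith
  have hnear : ∀ k, ‖π (s k) - 1‖ < 1 := fun k =>
    lt_of_le_of_lt ((hbound k).trans (mul_le_of_le_one_left (by norm_num)
      (pow_le_one₀ (by positivity) hlt.le))) (by norm_num)
  obtain ⟨k, hk⟩ : ∃ k, π (s k) = 1 := by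
    have h1 : Filter.Tendsto (fun k => π (s k)) Filter.atTop (nhds 1) := by
      rw [tendsto_iff_norm_sub_tendsto_zero]
      refine squeeze_zero (fun _ => norm_nonneg _) hbound ?_
      simpa using (tendsto_pow_atTop_nhds_zero_of_lt_one (by positivity) hlt).mul_const (2⁻¹ : ℝ)
    have h2 : IsClosed (Set.range π \ {1}) := (hfin.subset Set.sdiff_subset).isClosed
    by_contra! h3
    have := h2.mem_of_tendsto h1 (Filter.Eventually.of_forall fun k => ⟨⟨_, rfl⟩, h3 k⟩)
    exact this.2 rfl
  have hdesc : ∀ j, Commute (π x) (π (s j)) → Commute (π x) (π y) := by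
    intro j
    induction j with
    | zero => exact id
    | succ j ih =>
      refine fun hj => ih (commute_of_commute_conj hπ (hnear j) ?_)
      have h1 : s j * x⁻¹ * (s j)⁻¹ = x⁻¹ * s (j + 1) := by
        rw [hs, commutatorElement_def]
        group
      have h2 : Commute (π x) (π (s j * x⁻¹ * (s j)⁻¹)) := by
        rw [h1, map_mul]
        refine Commute.mul_right ?_ hj
        rw [Commute, SemiconjBy, ← map_mul, ← map_mul, mul_inv_cancel, inv_mul_cancel]
      have h3 : s j * x * (s j)⁻¹ = (s j * x⁻¹ * (s j)⁻¹)⁻¹ := by group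
      rw [h3]
      exact commute_map_inv_right π h2
  exact hdesc k (by rw [hk]; exact Commute.one_right _)

end Jordan

lemma commute_map_of_mem_closure {Γ M : Type*} [Group Γ] [Monoid M] (π : Γ →* M) {S : Set Γ}
    (hS : ∀ x ∈ S, ∀ y ∈ S, Commute (π x) (π y)) {x y : Γ} (hx : x ∈ Subgroup.closure S)
    (hy : y ∈ Subgroup.closure S) : Commute (π x) (π y) := by
  have key : ∀ m : M, (∀ y ∈ S, Commute m (π y)) → ∀ y ∈ Subgroup.closure S, Commute m (π y) := by
    intro m hm y hy
    induction hy using Subgroup.closure_induction with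
    | mem y hy => exact hm y hy
    | one => simp
    | mul a b _ _ ha hb => rw [map_mul]; exact ha.mul_right hb
    | inv a _ ha => exact commute_map_inv_right π ha
  exact key _ (fun b hb => (key _ (fun a ha => hS b hb a ha) x hx).symm) y hy

/-- A version of Jordan's theorem on finite linear groups. -/
theorem exists_abelian_subgroup_index_le (d : ℕ) : ∃ N : ℕ, ∀ {Γ : Type*} [Group Γ]
    (π : Γ →* (Cn d →L[ℂ] Cn d)), (∀ g v, ‖π g v‖ = ‖v‖) → (Set.range π).Finite →
      ∃ A : Subgroup Γ, A.FiniteIndex ∧ A.index ≤ N ∧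
        ∀ x ∈ A, ∀ y ∈ A, Commute (π x) (π y) := by
  have : ProperSpace (Cn d →L[ℂ] Cn d) := FiniteDimensional.proper ℂ _
  obtain ⟨t, -, htf, ht⟩ := (isCompact_closedBall (0 : Cn d →L[ℂ] Cn d) 1).finite_cover_balls
    (e := 1 / 4) (by norm_num)
  refine ⟨t.ncard, fun {Γ} _ π hπ hfin => ?_⟩
  let S : Set Γ := {g | ‖π g - 1‖ < 1 / 2}
  have hcover : ∀ g, ∃ c ∈ t, dist (π g) c < 1 / 4 := fun g => by
    have := ht (show π g ∈ _ by simpa using norm_map_le_one hπ g)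
    simpa using this
  choose c hct hc using hcover
  have : Finite t := htf
  have hinj : Function.Injective fun q : Γ ⧸ Subgroup.closure S => (⟨c q.out, hct _⟩ : t) := by
    intro p q hpq
    have h1 : c p.out = c q.out := congrArg Subtype.val hpq
    rw [← p.out_eq', ← q.out_eq', QuotientGroup.eq]
    refine Subgroup.subset_closure ((norm_map_sub_map hπ _ _).trans_lt ?_)
    rw [← dist_eq_norm]
    have h2 := hc q.out
    rw [← h1, dist_comm] at h2
    linarith [dist_triangle (π p.out) (c p.out) (π q.out), hc p.out]
  have hfq : Finite (Γ ⧸ Subgroup.closure S) := Finite.of_injective _ hinj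
  refine ⟨Subgroup.closure S, Subgroup.finiteIndex_of_finite_quotient, ?_, fun x hx y hy => ?_⟩
  · exact Nat.card_le_card_of_injective _ hinj
  · exact commute_map_of_mem_closure π (fun a ha b hb => commute_of_near_one hπ hfin ha hb) hx hy

section Conclusion

variable {Γ : Type*} [Group Γ]

lemma finite_monoidHom_of_fg [hfg : Group.FG Γ] (P : Type*) [Group P] [Finite P] :
    Finite (Γ →* P) := by
  obtain ⟨S, hS⟩ := hfg.out
  refine Finite.of_injective (fun (f : Γ →* P) (s : S) => f s) fun f g h => ?_
  exact MonoidHom.eq_of_eqOn_dense hS fun s hs => congrFun h ⟨s, hs⟩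

/-- In a finitely generated group, the subgroups of bounded index have a common subgroup of
finite index. -/
lemma exists_finiteIndex_le_of_index_le [Group.FG Γ] (N : ℕ) : ∃ K : Subgroup Γ, K.FiniteIndex ∧
    ∀ A : Subgroup Γ, A.FiniteIndex → A.index ≤ N → K ≤ A := by
  have hfin : ∀ m : ℕ, Finite (Γ →* Equiv.Perm (Fin m)) := fun m => finite_monoidHom_of_fg _
  refine ⟨⨅ (m : Fin (N + 1)) (f : Γ →* Equiv.Perm (Fin m)), f.ker,
    Subgroup.finiteIndex_iInf fun m => Subgroup.finiteIndex_iInf fun f =>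
      Subgroup.finiteIndex_ker f, fun A hA hAN => ?_⟩
  let e : Γ ⧸ A ≃ Fin A.index := Finite.equivFin _
  let f : Γ →* Equiv.Perm (Fin A.index) :=
    (e.permCongrHom : Equiv.Perm (Γ ⧸ A) →* _).comp (MulAction.toPermHom Γ (Γ ⧸ A))
  have hf : f.ker ≤ A := by
    refine le_trans ?_ A.normalCore_le
    rw [Subgroup.normalCore_eq_ker]
    intro x hx
    rw [MonoidHom.mem_ker] at hx ⊢
    exact e.permCongrHom.injective (hx.trans (map_one _).symm)
  exact ((iInf_le _ (⟨A.index, Nat.lt_succ_of_le hAN⟩ : Fin (N + 1))).trans (iInf_le _ f)).trans hf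

theorem OpStable.virtuallyAbelian [Group.FG Γ] (hrf : ResiduallyFinite Γ) (hΓ : OpStable Γ) :
    VirtuallyAbelian Γ := by
  obtain ⟨D, hD⟩ := hΓ.exists_irreducible_dim_le
  choose N hN using exists_abelian_subgroup_index_le
  obtain ⟨K, hK, hKA⟩ := exists_finiteIndex_le_of_index_le (Γ := Γ)
    ((Finset.range (D + 1)).sup N)
  refine ⟨K, hK, fun x hx y hy => ?_⟩
  rw [← commutatorElement_eq_one_iff_mul_comm]
  by_contra hne
  obtain ⟨d, π, hπ, hirr, hfin, hxy⟩ := hrf.exists_irreducible_ne_one hne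
  obtain ⟨A, hA, hAN, hcomm⟩ := hN d π hπ hfin
  have hle := hKA A hA (hAN.trans (Finset.le_sup (Finset.mem_range_succ_iff.2 (hD d π hπ hirr))))
  have h := hcomm x (hle hx) y (hle hy)
  refine hxy ?_
  rw [commutatorElement_def, map_mul, map_mul, map_mul, h.eq, ← map_mul, ← map_mul, ← map_mul,
    mul_inv_cancel_right, mul_inv_cancel, map_one]

end Conclusion

section Means

variable {Γ : Type*}

/-- Bounded complex functions. -/
def Bdd (f : Γ → ℂ) : Prop := ∃ C : ℝ, ∀ x, ‖f x‖ ≤ C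

/-- A mean on bounded functions; its values on unbounded functions are irrelevant. -/
structure IsMean (m : (Γ → ℂ) → ℂ) : Prop where
  add : ∀ {f g}, Bdd f → Bdd g → m (fun x => f x + g x) = m f + m g
  smul : ∀ (c : ℂ) {f}, Bdd f → m (fun x => c * f x) = c * m f
  norm_le : ∀ {f} {C : ℝ}, (∀ x, ‖f x‖ ≤ C) → ‖m f‖ ≤ C
  one : m (fun _ => 1) = 1
  nonneg : ∀ {r : Γ → ℝ}, Bdd (fun x => (r x : ℂ)) → (∀ x, 0 ≤ r x) → 0 ≤ (m fun x => (r x : ℂ)).re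
  map_conj : ∀ {f}, Bdd f → m (fun x => conj (f x)) = conj (m f)

lemma Bdd.add {f g : Γ → ℂ} (hf : Bdd f) (hg : Bdd g) : Bdd fun x => f x + g x := by
  obtain ⟨C, hC⟩ := hf
  obtain ⟨D, hD⟩ := hg
  exact ⟨C + D, fun x => (norm_add_le _ _).trans (add_le_add (hC x) (hD x))⟩

lemma Bdd.smul (c : ℂ) {f : Γ → ℂ} (hf : Bdd f) : Bdd fun x => c * f x := by
  obtain ⟨C, hC⟩ := hf
  exact ⟨‖c‖ * C, fun x => by rw [norm_mul]; exact mul_le_mul_of_nonneg_left (hC x) (norm_nonneg _)⟩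

lemma Bdd.star {f : Γ → ℂ} (hf : Bdd f) : Bdd fun x => conj (f x) := by
  obtain ⟨C, hC⟩ := hf
  exact ⟨C, fun x => by rw [RCLike.norm_conj]; exact hC x⟩

lemma Bdd.comp {f : Γ → ℂ} (hf : Bdd f) {Λ : Type*} (s : Λ → Γ) : Bdd fun x => f (s x) := by
  obtain ⟨C, hC⟩ := hf
  exact ⟨C, fun x => hC _⟩

lemma isMean_eval (x : Γ) : IsMean fun f => f x where
  add _ _ := rfl
  smul _ _ _ := rfl
  norm_le h := h x
  one := rfl
  nonneg _ h := h x
  map_conj _ := rfl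

lemma IsMean.exists_lim {ι : Type*} (U : Ultrafilter ι) {m : ι → (Γ → ℂ) → ℂ}
    (hm : ∀ i, IsMean (m i)) :
    ∃ m', IsMean m' ∧ ∀ f, Bdd f → Filter.Tendsto (fun i => m i f) U (nhds (m' f)) := by
  have hlim : ∀ f, ∃ z, Bdd f → Filter.Tendsto (fun i => m i f) U (nhds z) := by
    intro f
    by_cases hf : Bdd f
    · obtain ⟨C, hC⟩ := hf
      obtain ⟨z, -, hz⟩ := (isCompact_closedBall (0 : ℂ) C).ultrafilter_le_nhds
        (U.map fun i => m i f) (by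
          rw [Filter.le_principal_iff]
          exact Filter.Eventually.of_forall (f := (U : Filter ι)) fun i => by
            simpa using (hm i).norm_le hC)
      exact ⟨z, fun _ => hz⟩
    · exact ⟨0, fun h => absurd h hf⟩
  choose m' hm' using hlim
  have hone : Bdd (fun _ : Γ => (1 : ℂ)) := ⟨1, by simp⟩
  refine ⟨m', ⟨fun {f g} hf hg => ?_, fun c {f} hf => ?_, fun {f C} hC => ?_, ?_,
    fun {r} hr h => ?_, fun {f} hf => ?_⟩, fun f hf => hm' f hf⟩
  · refine tendsto_nhds_unique (hm' _ (hf.add hg)) ?_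
    simpa only [(hm _).add hf hg] using (hm' _ hf).add (hm' _ hg)
  · refine tendsto_nhds_unique (hm' _ (hf.smul c)) ?_
    simpa only [(hm _).smul c hf] using (hm' _ hf).const_mul c
  · exact le_of_tendsto (hm' f ⟨C, hC⟩).norm
      (Filter.Eventually.of_forall fun i => (hm i).norm_le hC)
  · refine tendsto_nhds_unique (hm' _ hone) ?_
    simpa only [(hm _).one] using tendsto_const_nhds
  · exact ge_of_tendsto ((Complex.continuous_re.tendsto _).comp (hm' _ hr))
      (Filter.Eventually.of_forall fun i => (hm i).nonneg hr h)
  · refine tendsto_nhds_unique (hm' _ hf.star) ?_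
    simpa only [(hm _).map_conj hf, Function.comp_def] using
      (Complex.continuous_conj.tendsto _).comp (hm' _ hf)

/-- Average of a mean over finitely many maps. -/
lemma IsMean.average {m : (Γ → ℂ) → ℂ} (hm : IsMean m) {ι : Type*} [Fintype ι] [Nonempty ι]
    (s : ι → Γ → Γ) :
    IsMean fun f => (Fintype.card ι : ℂ)⁻¹ * ∑ i, m fun x => f (s i x) := by
  have hcard : (Fintype.card ι : ℂ) ≠ 0 := by simp
  refine ⟨fun {f g} hf hg => ?_, fun c {f} hf => ?_, fun {f C} hC => ?_, ?_,
    fun {r} hr h => ?_, fun {f} hf => ?_⟩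
  · rw [← mul_add, ← Finset.sum_add_distrib]
    simp only [hm.add (hf.comp _) (hg.comp _)]
  · simp only [hm.smul c (hf.comp _), ← Finset.mul_sum]
    ring
  · rw [norm_mul, norm_inv, Complex.norm_natCast, inv_mul_le_iff₀ (by positivity)]
    refine (norm_sum_le _ _).trans
      ((Finset.sum_le_sum fun i _ => hm.norm_le fun x => hC _).trans ?_)
    simp
  · simp [hm.one]
  · have : ((Fintype.card ι : ℂ)⁻¹ * ∑ i, m fun x => (r (s i x) : ℂ)).re =
        (Fintype.card ι : ℝ)⁻¹ * ∑ i, (m fun x => (r (s i x) : ℂ)).re := by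
      rw [← Complex.re_sum, ← Complex.re_ofReal_mul]
      push_cast
      rfl
    rw [this]
    exact mul_nonneg (by positivity) (Finset.sum_nonneg fun i _ =>
      hm.nonneg (hr.comp (s i)) fun x => h _)
  · simp only [hm.map_conj (hf.comp _), map_mul, map_sum, map_inv₀, Complex.conj_natCast]

variable [Group Γ]

/-- Invariance of a mean under right translation by `s`. -/
def RightInvariant (m : (Γ → ℂ) → ℂ) (s : Γ) : Prop :=
  ∀ f, Bdd f → m (fun x => f (x * s)) = m f

lemma exists_mean_rightInvariant_of_commute {m : (Γ → ℂ) → ℂ} (hm : IsMean m) (s : Γ) :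
    ∃ m', IsMean m' ∧ RightInvariant m' s ∧
      ∀ t, Commute s t → RightInvariant m t → RightInvariant m' t := by
  have hmean := fun N : ℕ => hm.average (ι := Fin (N + 1)) fun i x => x * s ^ (i : ℕ)
  simp only [Fintype.card_fin] at hmean
  obtain ⟨m', hm', hlim⟩ := IsMean.exists_lim (Filter.hyperfilter ℕ) hmean
  refine ⟨m', hm', fun f hf => ?_, fun t hst ht f hf => ?_⟩
  · rw [← sub_eq_zero]
    refine tendsto_nhds_unique ((hlim _ (hf.comp fun x => x * s)).sub (hlim f hf)) ?_
    obtain ⟨C, hC⟩ := hf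
    have hbound : ∀ N : ℕ,
      ‖((N + 1 : ℕ) : ℂ)⁻¹ * (∑ i : Fin (N + 1), m fun x => f (x * s ^ (i : ℕ) * s))
        - ((N + 1 : ℕ) : ℂ)⁻¹ * ∑ i : Fin (N + 1), m fun x => f (x * s ^ (i : ℕ))‖
        ≤ (2 * C) * (1 / ((N : ℝ) + 1)) := by
      intro N
      have h1 : (∑ i : Fin (N + 1), m fun x => f (x * s ^ (i : ℕ) * s)) -
          ∑ i : Fin (N + 1), m (fun x => f (x * s ^ (i : ℕ))) =
          m (fun x => f (x * s ^ (N + 1))) - m (fun x => f (x * s ^ 0)) := by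
        rw [Fin.sum_univ_eq_sum_range (fun i => m fun x => f (x * s ^ i * s)),
          Fin.sum_univ_eq_sum_range (fun i => m fun x => f (x * s ^ i)),
          ← Finset.sum_range_sub (fun i => m fun x => f (x * s ^ i)), ← Finset.sum_sub_distrib]
        simp only [mul_assoc, ← pow_succ]
      rw [← mul_sub, h1, norm_mul, norm_inv, Complex.norm_natCast]
      have h2 := norm_sub_le (m fun x => f (x * s ^ (N + 1))) (m fun x => f (x * s ^ 0))
      have h3 := hm.norm_le fun x => hC (x * s ^ (N + 1))
      have h4 := hm.norm_le fun x => hC (x * s ^ 0)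
      rw [mul_comm, one_div]
      push_cast
      gcongr
      linarith
    refine (squeeze_zero_norm hbound ?_).mono_left Nat.hyperfilter_le_atTop
    simpa using tendsto_one_div_add_atTop_nhds_zero_nat.const_mul (2 * C)
  · refine tendsto_nhds_unique (hlim _ (hf.comp fun x => x * t)) ?_
    have key : ∀ i : ℕ, (m fun x => f (x * s ^ i * t)) = m fun x => f (x * s ^ i) := fun i => by
      rw [← ht _ (hf.comp fun x => x * s ^ i)]
      simp only [mul_assoc, (hst.pow_left i).eq]
    simpa only [key] using hlim f hf

lemma exists_mean_rightInvariant_finset (S : Finset Γ) (hS : ∀ x ∈ S, ∀ y ∈ S, Commute x y) :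
    ∃ m : (Γ → ℂ) → ℂ, IsMean m ∧ ∀ s ∈ S, RightInvariant m s := by
  classical
  induction S using Finset.induction_on with
  | empty => exact ⟨_, isMean_eval 1, by simp⟩
  | insert a S _ ih =>
    obtain ⟨m, hm, hmS⟩ := ih fun x hx y hy =>
      hS x (Finset.mem_insert_of_mem hx) y (Finset.mem_insert_of_mem hy)
    obtain ⟨m', hm', ha, hm'S⟩ := exists_mean_rightInvariant_of_commute hm a
    refine ⟨m', hm', fun s hs => ?_⟩
    rcases Finset.mem_insert.1 hs with rfl | hsS
    · exact ha
    · exact hm'S s (hS a (Finset.mem_insert_self _ _) s hs) (hmS s hsS)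

lemma RightInvariant.of_mem_closure {m : (Γ → ℂ) → ℂ} {S : Set Γ}
    (hS : ∀ s ∈ S, RightInvariant m s) {s : Γ} (hs : s ∈ Subgroup.closure S) :
    RightInvariant m s := by
  induction hs using Subgroup.closure_induction with
  | mem s h => exact hS s h
  | one => exact fun f _ => by simp
  | mul a b _ _ ha hb =>
    intro f hf
    rw [← hb f hf, ← ha _ (hf.comp fun x => x * b)]
    simp only [mul_assoc]
  | inv a _ ha =>
    intro f hf
    rw [← ha _ (hf.comp fun x => x * a⁻¹)]
    simp

/-- Virtually abelian finitely generated groups are amenable. -/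
theorem VirtuallyAbelian.exists_mean [Group.FG Γ] (h : VirtuallyAbelian Γ) :
    ∃ m : (Γ → ℂ) → ℂ, IsMean m ∧ ∀ s, RightInvariant m s := by
  obtain ⟨A, hA, hcomm⟩ := h
  obtain ⟨S, hS⟩ := (Group.fg_iff_subgroup_fg A).1 inferInstance
  have hSA : ∀ s ∈ S, s ∈ A := fun s hs => hS ▸ Subgroup.subset_closure hs
  obtain ⟨m, hm, hmS⟩ := exists_mean_rightInvariant_finset S fun x hx y hy =>
    hcomm x (hSA x hx) y (hSA y hy)
  have hmA : ∀ a ∈ A, RightInvariant m a := fun a ha =>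
    RightInvariant.of_mem_closure hmS (hS.symm ▸ ha)
  let _ : Fintype (Γ ⧸ A) := Fintype.ofFinite _
  refine ⟨_, hm.average (ι := Γ ⧸ A) fun q x => x * q.out⁻¹, fun g f hf => ?_⟩
  congr 1
  refine Fintype.sum_equiv (MulAction.toPerm g⁻¹) _ _ fun q => ?_
  simp only [MulAction.toPerm_apply]
  set r := g⁻¹ • q
  have hr : r.out⁻¹ * (g⁻¹ * q.out) ∈ A := by
    rw [← QuotientGroup.eq]
    refine (QuotientGroup.out_eq' r).trans ?_
    conv_lhs => rw [show r = g⁻¹ • q from rfl, ← QuotientGroup.out_eq' q]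
    rfl
  rw [← hmA _ (A.inv_mem hr) _ (hf.comp fun x => x * r.out⁻¹)]
  congr 1
  ext x
  congr 1
  group

end Means

section MeanInequalities

variable {Γ : Type*} {m : (Γ → ℂ) → ℂ}

lemma bdd_const (c : ℂ) : Bdd fun _ : Γ => c := ⟨‖c‖, fun _ => le_rfl⟩

lemma bdd_ofReal {r : Γ → ℝ} {C : ℝ} (h0 : ∀ x, 0 ≤ r x) (h : ∀ x, r x ≤ C) :
    Bdd fun x => (r x : ℂ) :=
  ⟨C, fun x => by simpa [abs_of_nonneg (h0 x)] using h x⟩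

lemma Bdd.sum {ι : Type*} (s : Finset ι) {f : ι → Γ → ℂ} (hf : ∀ i, Bdd (f i)) :
    Bdd fun x => ∑ i ∈ s, f i x := by
  choose C hC using hf
  exact ⟨∑ i ∈ s, C i, fun x => norm_sum_le_of_le s fun i _ => hC i x⟩

namespace IsMean

lemma map_const (hm : IsMean m) (c : ℂ) : m (fun _ => c) = c := by
  simpa [hm.one] using hm.smul c (bdd_const (1 : ℂ))

lemma map_sum (hm : IsMean m) {ι : Type*} (s : Finset ι) {f : ι → Γ → ℂ} (hf : ∀ i, Bdd (f i)) :
    m (fun x => ∑ i ∈ s, f i x) = ∑ i ∈ s, m (f i) := by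
  classical
  induction s using Finset.induction_on with
  | empty => simpa using hm.map_const 0
  | insert a s ha ih =>
    simp only [Finset.sum_insert ha]
    rw [hm.add (hf a) (Bdd.sum s hf), ih]

lemma re_le (hm : IsMean m) {r : Γ → ℝ} {C : ℝ} (h0 : ∀ x, 0 ≤ r x) (h : ∀ x, r x ≤ C) :
    (m fun x => (r x : ℂ)).re ≤ C :=
  (Complex.re_le_norm _).trans (hm.norm_le fun x => by simpa [abs_of_nonneg (h0 x)] using h x)

lemma le_re (hm : IsMean m) {r : Γ → ℝ} {c : ℝ} (hr : Bdd fun x => (r x : ℂ))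
    (h : ∀ x, c ≤ r x) : c ≤ (m fun x => (r x : ℂ)).re := by
  have h1 := hm.add hr (bdd_const (-(c : ℂ)))
  have h2 := hm.nonneg (r := fun x => r x - c)
    (by simpa [sub_eq_add_neg] using hr.add (bdd_const (-(c : ℂ)))) fun x => sub_nonneg.2 (h x)
  rw [hm.map_const] at h1
  simp only [sub_eq_add_neg, Complex.ofReal_add, Complex.ofReal_neg, h1] at h2
  simpa using h2

end IsMean

end MeanInequalities

section Dilation

universe u

variable {Γ : Type u} (E : Type) [NormedAddCommGroup E] [InnerProductSpace ℂ E]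

/-- Bounded `E`-valued functions. -/
def bddFun (Γ : Type u) (E : Type) [NormedAddCommGroup E] [InnerProductSpace ℂ E] :
    Submodule ℂ (Γ → E) where
  carrier := {f | ∃ C : ℝ, ∀ x, ‖f x‖ ≤ C}
  add_mem' := by
    rintro f g ⟨C, hC⟩ ⟨D, hD⟩
    exact ⟨C + D, fun x => norm_add_le_of_le (hC x) (hD x)⟩
  zero_mem' := ⟨0, by simp⟩
  smul_mem' := by
    rintro c f ⟨C, hC⟩
    exact ⟨‖c‖ * C, fun x => by
      rw [Pi.smul_apply, norm_smul]
      exact mul_le_mul_of_nonneg_left (hC x) (norm_nonneg _)⟩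

variable {E} in
lemma bdd_inner (f g : bddFun Γ E) : Bdd fun x => ⟪f.1 x, g.1 x⟫_ℂ := by
  obtain ⟨⟨f, C, hC⟩, ⟨g, D, hD⟩⟩ := f, g
  exact ⟨C * D, fun x => (norm_inner_le_norm _ _).trans
    (mul_le_mul (hC x) (hD x) (norm_nonneg _) ((norm_nonneg _).trans (hC x)))⟩

/-- Bounded `E`-valued functions with the semi-inner product given by a mean. -/
def MeanSpace {m : (Γ → ℂ) → ℂ} (_ : IsMean m) : Type u := bddFun Γ E

namespace MeanSpace

variable {m : (Γ → ℂ) → ℂ} (hm : IsMean m)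

instance : AddCommGroup (MeanSpace E hm) := inferInstanceAs (AddCommGroup (bddFun Γ E))
instance : Module ℂ (MeanSpace E hm) := inferInstanceAs (Module ℂ (bddFun Γ E))

/-- The semi-inner product of two bounded functions. -/
noncomputable abbrev preCore : PreInnerProductSpace.Core ℂ (MeanSpace E hm) where
  inner f g := m fun x => ⟪f.1 x, g.1 x⟫_ℂ
  conj_inner_symm f g := by
    rw [← hm.map_conj (bdd_inner g f)]
    simp only [inner_conj_symm]
  re_inner_nonneg f := by
    have h : (fun x => ⟪f.1 x, f.1 x⟫_ℂ) = fun x => ((‖f.1 x‖ ^ 2 : ℝ) : ℂ) := by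
      ext x
      simp [inner_self_eq_norm_sq_to_K]
    have hb := bdd_inner f f
    rw [h] at hb ⊢
    exact hm.nonneg hb fun x => by positivity
  add_left f g k := by
    rw [← hm.add (bdd_inner f k) (bdd_inner g k)]
    congr 1
    ext x
    exact inner_add_left _ _ _
  smul_left f g c := by
    rw [← hm.smul _ (bdd_inner f g)]
    congr 1
    ext x
    exact inner_smul_left _ _ _

noncomputable instance : SeminormedAddCommGroup (MeanSpace E hm) :=
  InnerProductSpace.Core.toSeminormedAddCommGroup (c := preCore E hm)
noncomputable instance : InnerProductSpace ℂ (MeanSpace E hm) :=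
  InnerProductSpace.ofCore (preCore E hm)

variable {E}

lemma inner_def (f g : MeanSpace E hm) : ⟪f, g⟫_ℂ = m fun x => ⟪f.1 x, g.1 x⟫_ℂ := rfl

lemma norm_sq_eq (f : MeanSpace E hm) : ‖f‖ ^ 2 = (m fun x => ((‖f.1 x‖ ^ 2 : ℝ) : ℂ)).re := by
  rw [← inner_self_eq_norm_sq (𝕜 := ℂ), inner_def]
  simp [inner_self_eq_norm_sq_to_K]

variable [Group Γ]

/-- Right translation as a linear isometry. -/
noncomputable def translate (hinv : ∀ s, RightInvariant m s) (g : Γ) :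
    MeanSpace E hm →ₗᵢ[ℂ] MeanSpace E hm where
  toFun f := ⟨fun x => f.1 (x * g), f.2.imp fun _ hC x => hC _⟩
  map_add' _ _ := rfl
  map_smul' _ _ := rfl
  norm_map' f := by
    rw [← sq_eq_sq₀ (norm_nonneg _) (norm_nonneg _), norm_sq_eq, norm_sq_eq]
    refine congrArg Complex.re (hinv g (fun x => ((‖f.1 x‖ ^ 2 : ℝ) : ℂ)) ?_)
    simpa [inner_self_eq_norm_sq_to_K] using bdd_inner f f

/-- Translations on the completion form a representation. -/
noncomputable def translateHom (hinv : ∀ s, RightInvariant m s) :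
    Γ →* (UniformSpace.Completion (MeanSpace E hm) →L[ℂ]
      UniformSpace.Completion (MeanSpace E hm)) where
  toFun g := (translate hm hinv g).toContinuousLinearMap.completion
  map_one' := by
    ext x
    induction x using UniformSpace.Completion.induction_on with
    | hp => exact isClosed_eq (ContinuousLinearMap.continuous _) continuous_id
    | ih f =>
      rw [ContinuousLinearMap.completion_apply_coe]
      refine congrArg _ (Subtype.ext (funext fun x => ?_))
      exact congrArg f.1 (mul_one x)
  map_mul' g h := by
    ext x
    induction x using UniformSpace.Completion.induction_on with
    | hp => exact isClosed_eq (ContinuousLinearMap.continuous _) (ContinuousLinearMap.continuous _)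
    | ih f =>
      rw [mul_apply_eq_comp]
      simp only [ContinuousLinearMap.completion_apply_coe]
      refine congrArg _ (Subtype.ext (funext fun x => ?_))
      exact congrArg f.1 (mul_assoc x g h).symm

lemma translateHom_coe (hinv : ∀ s, RightInvariant m s) (g : Γ) (f : MeanSpace E hm) :
    translateHom hm hinv g (f : UniformSpace.Completion (MeanSpace E hm)) =
      ((translate hm hinv g f : MeanSpace E hm) : UniformSpace.Completion (MeanSpace E hm)) :=
  ContinuousLinearMap.completion_apply_coe _ _

lemma norm_translateHom (hinv : ∀ s, RightInvariant m s) (g : Γ)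
    (x : UniformSpace.Completion (MeanSpace E hm)) : ‖translateHom hm hinv g x‖ = ‖x‖ := by
  induction x using UniformSpace.Completion.induction_on with
  | hp => exact isClosed_eq (ContinuousLinearMap.continuous _).norm continuous_norm
  | ih f =>
    rw [translateHom_coe, UniformSpace.Completion.norm_coe, UniformSpace.Completion.norm_coe,
      LinearIsometry.norm_map]

/-- The orbit map `v ↦ φ(·) v`. -/
noncomputable def orbit (φ : Γ → E →L[ℂ] E) (hφ : ∀ g v, ‖φ g v‖ = ‖v‖) :
    E →ₗᵢ[ℂ] MeanSpace E hm where
  toFun v := ⟨fun x => φ x v, ‖v‖, fun x => (hφ x v).le⟩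
  map_add' v w := Subtype.ext (funext fun x => map_add (φ x) v w)
  map_smul' c v := Subtype.ext (funext fun x => map_smul (φ x) c v)
  norm_map' v := by
    rw [← sq_eq_sq₀ (norm_nonneg _) (norm_nonneg _), norm_sq_eq]
    change (m fun x => ((‖φ x v‖ ^ 2 : ℝ) : ℂ)).re = _
    simp only [hφ, hm.map_const, Complex.ofReal_re]

end MeanSpace

/-- An approximate homomorphism of an amenable group is approximately a subrepresentation of a
genuine unitary representation. -/
theorem exists_dilation [Group Γ] {m : (Γ → ℂ) → ℂ} (hm : IsMean m)
    (hinv : ∀ s, RightInvariant m s) {n : ℕ} (φ : Γ → Cn n →L[ℂ] Cn n)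
    (hφ : ∀ g v, ‖φ g v‖ = ‖v‖) {c : ℝ} (hc : 0 ≤ c)
    (h : ∀ g h, hs (φ g ∘L φ h - φ (g * h)) ≤ c) :
    ∃ (H : Type u) (_ : NormedAddCommGroup H) (_ : InnerProductSpace ℂ H) (_ : CompleteSpace H)
      (π : Γ →* (H →L[ℂ] H)) (V : Cn n →L[ℂ] H), (∀ g x, ‖π g x‖ = ‖x‖) ∧ (∀ v, ‖V v‖ = ‖v‖) ∧
      ∀ g, hs (π g ∘L V - V ∘L φ g) ≤ c := by
  refine ⟨UniformSpace.Completion (MeanSpace (Cn n) hm), inferInstance, inferInstance,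
    inferInstance, MeanSpace.translateHom hm hinv,
    (UniformSpace.Completion.toComplₗᵢ.comp (MeanSpace.orbit hm φ hφ)).toContinuousLinearMap,
    MeanSpace.norm_translateHom hm hinv, fun v => LinearIsometry.norm_map _ v, fun g => ?_⟩
  refine le_of_sq_le_sq ?_ hc
  have hsum : ∀ (j : Fin n), Bdd fun x => ((‖(φ (x * g) - φ x ∘L φ g)
      (EuclideanSpace.single j 1)‖ ^ 2 : ℝ) : ℂ) := fun j =>
    bdd_ofReal (C := 2 ^ 2) (fun _ => by positivity) fun x => by
      gcongr
      refine (norm_sub_le _ _).trans ?_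
      change ‖φ (x * g) _‖ + ‖φ x (φ g _)‖ ≤ 2
      rw [hφ, hφ, hφ]
      norm_num
  rw [hs_sq]
  have hterm : ∀ j : Fin n, ‖(MeanSpace.translateHom hm hinv g ∘L
      (UniformSpace.Completion.toComplₗᵢ.comp (MeanSpace.orbit hm φ hφ)).toContinuousLinearMap -
      (UniformSpace.Completion.toComplₗᵢ.comp (MeanSpace.orbit hm φ hφ)).toContinuousLinearMap ∘L
      φ g) (EuclideanSpace.single j 1)‖ ^ 2 = (m fun x => ((‖(φ (x * g) - φ x ∘L φ g)
      (EuclideanSpace.single j 1)‖ ^ 2 : ℝ) : ℂ)).re := by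
    intro j
    set e : Cn n := EuclideanSpace.single j 1
    have : (MeanSpace.translateHom hm hinv g ∘L
      (UniformSpace.Completion.toComplₗᵢ.comp (MeanSpace.orbit hm φ hφ)).toContinuousLinearMap -
      (UniformSpace.Completion.toComplₗᵢ.comp (MeanSpace.orbit hm φ hφ)).toContinuousLinearMap ∘L
      φ g) e = ((MeanSpace.translate hm hinv g (MeanSpace.orbit hm φ hφ e) -
        MeanSpace.orbit hm φ hφ (φ g e) : MeanSpace (Cn n) hm) :
          UniformSpace.Completion (MeanSpace (Cn n) hm)) := by
      rw [UniformSpace.Completion.coe_sub, ← MeanSpace.translateHom_coe]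
      rfl
    rw [this, UniformSpace.Completion.norm_coe, MeanSpace.norm_sq_eq]
    rfl
  rw [Finset.sum_congr rfl fun j _ => hterm j, ← Complex.re_sum, ← hm.map_sum _ hsum]
  simp only [← Complex.ofReal_sum]
  refine hm.re_le (fun x => by positivity) fun x => ?_
  rw [← hs_sq, hs_sub_comm]
  gcongr
  exacts [hs_nonneg _, h x g]

end Dilation

section AveragedOperator

variable {Γ : Type*} [Group Γ] {H F : Type*} [NormedAddCommGroup H] [InnerProductSpace ℂ H]
  [CompleteSpace H] [NormedAddCommGroup F] [InnerProductSpace ℂ F]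

/-- The average over the group of the positive operator `W† W`. -/
theorem exists_averaged_operator {m : (Γ → ℂ) → ℂ} (hm : IsMean m)
    (hinv : ∀ s, RightInvariant m s) {π : Γ →* (H →L[ℂ] H)} (hπ : ∀ g x, ‖π g x‖ = ‖x‖)
    (W : H →L[ℂ] F) (hW : ∀ x, ‖W x‖ ≤ ‖x‖) :
    ∃ T : H →L[ℂ] H, IsSelfAdjoint T ∧ (∀ g, Commute T (π g)) ∧
      ∀ x, (⟪T x, x⟫_ℂ).re = (m fun g => ((‖W (π g x)‖ ^ 2 : ℝ) : ℂ)).re := by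
  have hbound : ∀ x y g, ‖⟪W (π g x), W (π g y)⟫_ℂ‖ ≤ ‖x‖ * ‖y‖ := fun x y g =>
    (norm_inner_le_norm _ _).trans (mul_le_mul ((hW _).trans (hπ g x).le)
      ((hW _).trans (hπ g y).le) (norm_nonneg _) (norm_nonneg _))
  have hb : ∀ x y, Bdd fun g => ⟪W (π g x), W (π g y)⟫_ℂ := fun x y => ⟨_, hbound x y⟩
  let B : H →ₗ⋆[ℂ] H →ₗ[ℂ] ℂ := LinearMap.mk₂'ₛₗ (starRingEnd ℂ) (RingHom.id ℂ)
    (fun x y => m fun g => ⟪W (π g x), W (π g y)⟫_ℂ)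
    (fun x x' y => by simp only [map_add, inner_add_left, hm.add (hb x y) (hb x' y)])
    (fun c x y => by
      simp only [map_smul, inner_smul_left, hm.smul _ (hb x y), smul_eq_mul])
    (fun x y y' => by simp only [map_add, inner_add_right, hm.add (hb x y) (hb x y')])
    (fun c x y => by
      simp only [map_smul, inner_smul_right, hm.smul _ (hb x y), smul_eq_mul, RingHom.id_apply])
  let T := InnerProductSpace.continuousLinearMapOfBilin (B.mkContinuous₂ 1 fun x y => by
    rw [one_mul]
    exact hm.norm_le (hbound x y))
  have hT : ∀ x y, ⟪T x, y⟫_ℂ = m fun g => ⟪W (π g x), W (π g y)⟫_ℂ := fun x y =>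
    InnerProductSpace.continuousLinearMapOfBilin_apply _ _ _
  refine ⟨T, ?_, fun s => ?_, fun x => ?_⟩
  · rw [ContinuousLinearMap.isSelfAdjoint_iff_isSymmetric]
    intro x y
    change ⟪T x, y⟫_ℂ = ⟪x, T y⟫_ℂ
    rw [← inner_conj_symm x, hT, hT, ← hm.map_conj (hb y x)]
    simp only [inner_conj_symm]
  · refine ContinuousLinearMap.ext fun x => ext_inner_right ℂ fun y => ?_
    have hy := (map_apply_map_inv_apply π s y).symm
    rw [mul_apply_eq_comp, mul_apply_eq_comp]
    conv_rhs => rw [hy, inner_map_map_of_isometric hπ]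
    rw [hT, hT, ← hinv s _ (hb x _)]
    congr 1
    ext g
    rw [map_mul, mul_apply_eq_comp, mul_apply_eq_comp, map_apply_map_inv_apply]
  · rw [hT]
    simp [inner_self_eq_norm_sq_to_K]

/-- A self-adjoint operator is nonnegative on the range of its positive part and nonpositive on
the kernel of it. -/
theorem exists_positive_part (a : H →L[ℂ] H) (ha : IsSelfAdjoint a) :
    ∃ p : H →L[ℂ] H, IsSelfAdjoint p ∧ (∀ b, Commute a b → Commute p b) ∧
      (∀ x, 0 ≤ (⟪a (p x), p x⟫_ℂ).re) ∧ ∀ x, p x = 0 → (⟪a x, x⟫_ℂ).re ≤ 0 := by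
  have hpos : ∀ T : H →L[ℂ] H, 0 ≤ T → ∀ x, 0 ≤ (⟪T x, x⟫_ℂ).re := fun T hT x =>
    ((ContinuousLinearMap.nonneg_iff_isPositive T).1 hT).re_inner_nonneg_left x
  have hsub : ∀ y, a y = a⁺ y - a⁻ y := fun y =>
    (congrArg (fun T : H →L[ℂ] H => T y) (CFC.posPart_sub_negPart a)).symm
  have hmul : a⁻ * a⁺ = 0 := CFC.negPart_mul_posPart a
  refine ⟨a⁺, (CFC.posPart_nonneg a).isSelfAdjoint, fun b hb => ?_, fun x => ?_, fun x hx => ?_⟩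
  · exact hb.cfcₙ_real _
  · have h : a (a⁺ x) = a⁺ (a⁺ x) := by
      have := congrArg (fun T : H →L[ℂ] H => T x) hmul
      simp only [mul_apply_eq_comp, zero_apply] at this
      rw [hsub, this, sub_zero]
    rw [h]
    exact hpos _ (CFC.posPart_nonneg a) _
  · rw [hsub, hx, zero_sub, inner_neg_left, Complex.neg_re]
    exact neg_nonpos.2 (hpos _ (CFC.negPart_nonneg a) x)

end AveragedOperator

section SpectralSubspace

variable {H : Type*} [NormedAddCommGroup H] [InnerProductSpace ℂ H] [CompleteSpace H]

/-- The subspace where a self-adjoint operator is above a threshold. -/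
theorem exists_spectral_subspace (T : H →L[ℂ] H) (hT : IsSelfAdjoint T) (θ : ℝ) :
    ∃ R : Submodule ℂ H, (∀ b, Commute T b → ∀ v ∈ R, b v ∈ R) ∧
      (∀ v ∈ R, θ * ‖v‖ ^ 2 ≤ (⟪T v, v⟫_ℂ).re) ∧ ∀ v ∈ Rᗮ, (⟪T v, v⟫_ℂ).re ≤ θ * ‖v‖ ^ 2 := by
  have hθ : IsSelfAdjoint ((θ : ℂ) • (1 : H →L[ℂ] H)) :=
    IsSelfAdjoint.smul (Complex.conj_ofReal θ) (IsSelfAdjoint.one _)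
  have hre : ∀ v, (⟪(T - (θ : ℂ) • (1 : H →L[ℂ] H)) v, v⟫_ℂ).re =
      (⟪T v, v⟫_ℂ).re - θ * ‖v‖ ^ 2 := fun v => by
    rw [sub_apply, smul_apply, one_apply_eq_self, inner_sub_left, inner_smul_left,
      Complex.conj_ofReal, inner_self_eq_norm_sq_to_K, Complex.sub_re]
    simp [← Complex.ofReal_pow]
  obtain ⟨p, hp, hcomm, hpos, hneg⟩ := exists_positive_part _ (hT.sub hθ)
  refine ⟨LinearMap.range p.toLinearMap, fun b hb => ?_, ?_, fun v hv => ?_⟩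
  · rintro _ ⟨x, rfl⟩
    have h := hcomm b (hb.sub_left ((Commute.one_left b).smul_left _))
    exact ⟨b x, congrArg (fun S : H →L[ℂ] H => S x) h.eq⟩
  · rintro _ ⟨x, rfl⟩
    have h := hpos x
    rw [hre] at h
    exact sub_nonneg.1 h
  · have h := hneg v (ext_inner_left ℂ fun w => by
      rw [inner_zero_right, ← ContinuousLinearMap.adjoint_inner_left,
        ContinuousLinearMap.isSelfAdjoint_iff'.1 hp]
      exact (Submodule.mem_orthogonal _ _).1 hv _ ⟨w, rfl⟩)
    rw [hre] at h
    exact sub_nonpos.1 h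

/-- The quadratic form of an operator with an invariant subspace. -/
lemma inner_le_of_invariant_subspace {T : H →L[ℂ] H} (hT : IsSelfAdjoint T) {θ : ℝ}
    {R : Submodule ℂ H} [R.HasOrthogonalProjection] (hR : ∀ v ∈ R, T v ∈ R)
    (hRT : ∀ v ∈ Rᗮ, (⟪T v, v⟫_ℂ).re ≤ θ * ‖v‖ ^ 2) (x : H) :
    (⟪T x, x⟫_ℂ).re ≤ (⟪T (R.starProjection x), R.starProjection x⟫_ℂ).re +
      θ * (‖x‖ ^ 2 - ‖R.starProjection x‖ ^ 2) := by
  obtain ⟨u, hu', w, hw', hx⟩ : ∃ u, R.starProjection x = u ∧ ∃ w, x - u = w ∧ x = u + w :=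
    ⟨_, rfl, _, rfl, (add_sub_cancel _ _).symm⟩
  have hu : u ∈ R := hu' ▸ Submodule.starProjection_apply_mem _ _
  have hw : w ∈ Rᗮ := by
    rw [← hw', ← hu']
    exact R.sub_starProjection_mem_orthogonal x
  have h1 : ⟪T u, w⟫_ℂ = 0 := (Submodule.mem_orthogonal _ _).1 hw _ (hR u hu)
  have h2 : ⟪T w, u⟫_ℂ = 0 := by
    rw [← ContinuousLinearMap.adjoint_inner_right, ContinuousLinearMap.isSelfAdjoint_iff'.1 hT]
    exact (Submodule.mem_orthogonal' _ _).1 hw _ (hR u hu)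
  have h3 : ‖x‖ ^ 2 = ‖u‖ ^ 2 + ‖w‖ ^ 2 := by
    have := norm_add_sq_eq_norm_sq_add_norm_sq_of_inner_eq_zero (𝕜 := ℂ) u w
      ((Submodule.mem_orthogonal _ _).1 hw _ hu)
    rw [hx, sq, sq, sq, this]
  have h4 : (⟪T x, x⟫_ℂ).re = (⟪T u, u⟫_ℂ).re + (⟪T w, w⟫_ℂ).re := by
    rw [hx, map_add, inner_add_left, inner_add_right, inner_add_right, h1, h2]
    simp
  rw [hu', h3, h4, add_sub_cancel_left]
  exact add_le_add le_rfl (hRT w hw)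

/-- A subspace all of whose finite-dimensional subspaces have bounded dimension is
finite-dimensional. -/
lemma finiteDimensional_of_finrank_le {K E : Type*} [Field K] [AddCommGroup E] [Module K E]
    (R : Submodule K E) (N : ℕ)
    (h : ∀ W ≤ R, FiniteDimensional K W → Module.finrank K W ≤ N) : FiniteDimensional K R := by
  have hr : Module.rank K R ≤ N := rank_le fun s hs => by
    have hs' : LinearIndependent K fun i : s => ((i : R) : E) :=
      hs.map' R.subtype R.ker_subtype
    have hW := h (Submodule.span K (Set.range fun i : s => ((i : R) : E)))
      (Submodule.span_le.2 (by rintro _ ⟨i, rfl⟩; exact i.1.2))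
      (FiniteDimensional.span_of_finite K (Set.finite_range _))
    rwa [finrank_span_eq_card hs', Fintype.card_coe] at hW
  exact Module.rank_lt_aleph0_iff.1 (hr.trans_lt (Cardinal.natCast_lt_aleph0))

/-- An operator close to one with values in the range of an isometry is mostly captured by it. -/
lemma hs_sq_sub_le_hs_adjoint_comp_sq {n : ℕ} {V : Cn n →L[ℂ] H} (hV : ∀ v, ‖V v‖ = ‖v‖)
    (A : Cn n →L[ℂ] H) (B : Cn n →L[ℂ] Cn n) :
    hs A ^ 2 - hs (A - V ∘L B) ^ 2 ≤ hs (V.adjoint ∘L A) ^ 2 := by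
  let ι : Cn n →ₗᵢ[ℂ] H := ⟨V.toLinearMap, hV⟩
  let R := LinearMap.range ι.toLinearMap
  have hP : V ∘L V.adjoint = R.starProjection := comp_adjoint_eq_starProjection ι
  have h1 : hs (V.adjoint ∘L A) = hs (R.starProjection ∘L A) := by
    rw [← hP, ContinuousLinearMap.comp_assoc, hs_comp_left_of_isometric V hV]
  have h2 : R.starProjection ∘L A - A = -(Rᗮ.starProjection ∘L (A - V ∘L B)) := by
    ext1 v
    have hv : Rᗮ.starProjection (V (B v)) = 0 := by
      rw [Submodule.starProjection_orthogonal_val, sub_eq_zero]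
      exact (Submodule.starProjection_eq_self_iff.2 (show V (B v) ∈ R from ⟨B v, rfl⟩)).symm
    simp only [sub_apply, neg_apply, ContinuousLinearMap.comp_apply, map_sub, hv, sub_zero]
    rw [Submodule.starProjection_orthogonal_val, neg_sub]
  have h3 : hs (R.starProjection ∘L A - A) ≤ hs (A - V ∘L B) := by
    rw [h2, ← zero_sub, hs_sub_comm, sub_zero]
    simpa using hs_comp_left_le zero_le_one Rᗮ.starProjection
      (fun v => by rw [one_mul]; exact Rᗮ.norm_starProjection_apply_le v) (A - V ∘L B)
  rw [h1, sub_le_iff_le_add, hs_sq_eq_add_starProjection R A]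
  gcongr
  exact hs_nonneg _

variable {Γ : Type*} [Group Γ]

/-- An approximate subrepresentation of dimension `n` is close to a genuine subrepresentation of
dimension at most slightly larger than `n`. -/
theorem exists_invariant_subspace_near {m : (Γ → ℂ) → ℂ} (hm : IsMean m)
    (hinv : ∀ s, RightInvariant m s) {π : Γ →* (H →L[ℂ] H)} (hπ : ∀ g x, ‖π g x‖ = ‖x‖)
    {n : ℕ} {φ : Γ → Cn n →L[ℂ] Cn n} {V : Cn n →L[ℂ] H} (hV : ∀ v, ‖V v‖ = ‖v‖)
    {ε : ℝ} (hε : 0 < ε) (hε1 : ε < 1) (h : ∀ g, hs (π g ∘L V - V ∘L φ g) ≤ ε * √n) :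
    ∃ (R : Submodule ℂ H) (_ : FiniteDimensional ℂ R), (∀ g, ∀ v ∈ R, π g v ∈ R) ∧
      (1 - ε) * Module.finrank ℂ R ≤ n ∧ (1 - ε) * n ≤ hs (R.starProjection ∘L V) ^ 2 := by
  have hW : ∀ x, ‖V.adjoint x‖ ≤ ‖x‖ := adjoint_apply_norm_le V fun v => (hV v).le
  obtain ⟨T, hT, hTπ, hTm⟩ := exists_averaged_operator hm hinv hπ V.adjoint hW
  have hb : ∀ x, Bdd fun g => ((‖V.adjoint (π g x)‖ ^ 2 : ℝ) : ℂ) := fun x =>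
    bdd_ofReal (C := ‖x‖ ^ 2) (fun _ => by positivity) fun g => by
      gcongr
      exact (hW _).trans (hπ g x).le
  have hT1 : ∀ x, (⟪T x, x⟫_ℂ).re ≤ ‖x‖ ^ 2 := fun x => by
    rw [hTm]
    refine hm.re_le (fun _ => by positivity) fun g => ?_
    gcongr
    exact (hW _).trans (hπ g x).le
  have hTsum : ∀ {ι : Type} [Fintype ι] (r : ι → H), ∑ i, (⟪T (r i), r i⟫_ℂ).re =
      (m fun g => ((∑ i, ‖V.adjoint (π g (r i))‖ ^ 2 : ℝ) : ℂ)).re := fun r => by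
    simp only [hTm, ← Complex.re_sum, Complex.ofReal_sum]
    rw [hm.map_sum _ fun i => hb (r i)]
  have hTtop : ∀ {ι : Type} [Fintype ι] (r : ι → H), Orthonormal ℂ r →
      ∑ i, (⟪T (r i), r i⟫_ℂ).re ≤ n := fun r hr => by
    rw [hTsum]
    refine hm.re_le (fun _ => by positivity) fun g => ?_
    rw [← hs_sq_of_isometric V hV]
    exact sum_adjoint_sq_le (hr.comp_linearIsometry ⟨(π g).toLinearMap, hπ g⟩) V
  have hTbot : (1 - ε ^ 2) * n ≤ ∑ j : Fin n, (⟪T (V (EuclideanSpace.single j 1)),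
      V (EuclideanSpace.single j 1)⟫_ℂ).re := by
    rw [hTsum]
    refine hm.le_re ?_ fun g => ?_
    · simpa only [Complex.ofReal_sum] using Bdd.sum Finset.univ fun j : Fin n =>
        hb (V (EuclideanSpace.single j 1))
    · have h1 := hs_sq_sub_le_hs_adjoint_comp_sq hV (π g ∘L V) (φ g)
      have h2 : hs (π g ∘L V - V ∘L φ g) ^ 2 ≤ (ε * √n) ^ 2 := by
        gcongr
        exacts [hs_nonneg _, h g]
      rw [hs_sq_of_isometric _ fun v => by rw [ContinuousLinearMap.comp_apply, hπ, hV],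
        hs_sq (V.adjoint ∘L _)] at h1
      rw [mul_pow, Real.sq_sqrt (Nat.cast_nonneg n)] at h2
      simp only [ContinuousLinearMap.comp_apply] at h1
      linarith
  obtain ⟨R, hR, hRT, hRT'⟩ := exists_spectral_subspace T hT (1 - ε)
  have hdim : ∀ W ≤ R, FiniteDimensional ℂ W → (1 - ε) * Module.finrank ℂ W ≤ n := by
    intro W hWR _
    let b := stdOrthonormalBasis ℂ W
    have hbo : Orthonormal ℂ fun i => (b i : H) := b.orthonormal.comp_linearIsometry W.subtypeₗᵢ
    calc (1 - ε) * Module.finrank ℂ W = ∑ i, (1 - ε) * ‖(b i : H)‖ ^ 2 := by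
          simp [hbo.1]
          ring
      _ ≤ _ := Finset.sum_le_sum fun i _ => hRT _ (hWR (b i).2)
      _ ≤ n := hTtop _ hbo
  have hfin : FiniteDimensional ℂ R := finiteDimensional_of_finrank_le R ⌊n / (1 - ε)⌋₊
    fun W hWR hWf => Nat.le_floor (by
      rw [le_div_iff₀ (sub_pos.2 hε1), mul_comm]
      exact hdim W hWR hWf)
  have hdimR := hdim R le_rfl hfin
  refine ⟨R, hfin, fun g => hR (π g) (hTπ g), hdimR, ?_⟩
  have hsplit : ∀ x, (⟪T x, x⟫_ℂ).re ≤
      ‖R.starProjection x‖ ^ 2 + (1 - ε) * (‖x‖ ^ 2 - ‖R.starProjection x‖ ^ 2) := fun x => by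
    have h1 := inner_le_of_invariant_subspace hT (hR T (Commute.refl T)) hRT' x
    have h2 := hT1 (R.starProjection x)
    linarith
  have hsum := hTbot.trans (Finset.sum_le_sum fun j _ => hsplit (V (EuclideanSpace.single j 1)))
  have hsum := hTbot.trans (Finset.sum_le_sum fun j _ => hsplit (V (EuclideanSpace.single j 1)))
  have hS : hs (R.starProjection ∘L V) ^ 2 =
      ∑ j : Fin n, ‖R.starProjection (V (EuclideanSpace.single j 1))‖ ^ 2 := hs_sq _
  have hn := (hs_sq V).symm.trans (hs_sq_of_isometric V hV)
  rw [Finset.sum_add_distrib, ← Finset.mul_sum, Finset.sum_sub_distrib, hn, ← hS] at hsum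
  nlinarith

end SpectralSubspace

section SmallSubrepresentations

variable {Γ : Type*} [Group Γ] {E : Type*} [NormedAddCommGroup E] [InnerProductSpace ℂ E]
  {π : Γ →* (E →L[ℂ] E)}

/-- Representations of virtually abelian groups have small subrepresentations. -/
lemma exists_small_invariant_subspace (A : Subgroup Γ) [A.FiniteIndex]
    (hA : ∀ x ∈ A, ∀ y ∈ A, x * y = y * x) (hπ : ∀ g v, ‖π g v‖ = ‖v‖) (R : Submodule ℂ E)
    [FiniteDimensional ℂ R] (hR : ∀ g, ∀ v ∈ R, π g v ∈ R) (hR0 : R ≠ ⊥) :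
    ∃ W ≤ R, W ≠ ⊥ ∧ (∀ g, ∀ v ∈ W, π g v ∈ W) ∧ FiniteDimensional ℂ W ∧
      Module.finrank ℂ W ≤ A.index := by
  obtain ⟨v, hvR, hv0, hv⟩ := exists_common_eigenvector (fun a : A => (π a).toLinearMap) R hR0
    (fun a v hv => hR a v hv) fun a b v _ => by
      have h := congrArg (fun s => π s v) (hA a a.2 b b.2)
      simp only [map_mul, mul_apply_eq_comp] at h
      exact h
  let _ : Fintype (Γ ⧸ A) := Fintype.ofFinite _
  let f : Γ ⧸ A → E := fun q => π q.out v
  refine ⟨Submodule.span ℂ (Set.range f), Submodule.span_le.2 ?_, fun h => hv0 ?_, fun g => ?_,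
    FiniteDimensional.span_of_finite ℂ (Set.finite_range f), ?_⟩
  · rintro _ ⟨q, rfl⟩
    exact hR _ _ hvR
  · have h1 : f (1 : Γ) ∈ Submodule.span ℂ (Set.range f) := Submodule.subset_span ⟨_, rfl⟩
    rw [h, Submodule.mem_bot] at h1
    rw [← norm_eq_zero, ← hπ, norm_eq_zero]
    exact h1
  · suffices Submodule.span ℂ (Set.range f) ≤
        (Submodule.span ℂ (Set.range f)).comap (π g).toLinearMap from this
    rw [Submodule.span_le]
    rintro _ ⟨q, rfl⟩
    set r := g • q
    have hr : r.out⁻¹ * (g * q.out) ∈ A := by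
      rw [← QuotientGroup.eq]
      refine (QuotientGroup.out_eq' r).trans ?_
      conv_lhs => rw [show r = g • q from rfl, ← QuotientGroup.out_eq' q]
      rfl
    obtain ⟨μ, hμ⟩ := hv ⟨_, hr⟩
    have h1 : π g (f q) = μ • f r := by
      have h2 : g * q.out = r.out * (r.out⁻¹ * (g * q.out)) := by group
      have h3 := congrArg (fun s => π s v) h2
      simp only [map_mul π g, map_mul π r.out, mul_apply_eq_comp] at h3
      rw [← map_smul, ← hμ]
      exact h3
    change π g (f q) ∈ Submodule.span ℂ (Set.range f)
    rw [h1]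
    exact Submodule.smul_mem _ _ (Submodule.subset_span ⟨r, rfl⟩)
  · rw [Subgroup.index_eq_card, Nat.card_eq_fintype_card]
    exact finrank_range_le_card f

/-- Representations of virtually abelian groups have subrepresentations of almost prescribed
dimension. -/
lemma exists_invariant_subspace_finrank (A : Subgroup Γ) [A.FiniteIndex]
    (hA : ∀ x ∈ A, ∀ y ∈ A, x * y = y * x) (hπ : ∀ g v, ‖π g v‖ = ‖v‖) (N : ℕ) (R : Submodule ℂ E)
    [FiniteDimensional ℂ R] (hR : ∀ g, ∀ v ∈ R, π g v ∈ R) (hN : N < Module.finrank ℂ R) :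
    ∃ W ≤ R, (∀ g, ∀ v ∈ W, π g v ∈ W) ∧ FiniteDimensional ℂ W ∧ Module.finrank ℂ W ≤ N ∧
      N < Module.finrank ℂ W + A.index := by
  obtain ⟨k, hk⟩ : ∃ k, Module.finrank ℂ R = k := ⟨_, rfl⟩
  induction k using Nat.strong_induction_on generalizing R with
  | _ k ih =>
    have hR0 : R ≠ ⊥ := by
      rintro rfl
      simp at hN
    obtain ⟨W, hWR, hW0, hW, hWf, hWd⟩ := exists_small_invariant_subspace A hA hπ R hR hR0
    have hsum := Submodule.finrank_add_inf_finrank_orthogonal hWR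
    have hWpos : 0 < Module.finrank ℂ W := by
      rwa [Nat.pos_iff_ne_zero, Ne, Submodule.finrank_eq_zero]
    have hinv : ∀ g, ∀ v ∈ Wᗮ ⊓ R, π g v ∈ Wᗮ ⊓ R := fun g v hv =>
      ⟨map_mem_orthogonal hπ hW g hv.1, hR g v hv.2⟩
    have hf : FiniteDimensional ℂ (Wᗮ ⊓ R : Submodule ℂ E) :=
      Submodule.finiteDimensional_of_le inf_le_right
    by_cases h : Module.finrank ℂ (Wᗮ ⊓ R : Submodule ℂ E) ≤ N
    · exact ⟨Wᗮ ⊓ R, inf_le_right, hinv, hf, h, by omega⟩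
    · obtain ⟨W', hW', hrest⟩ := ih _ (by omega) (Wᗮ ⊓ R) hinv (not_le.1 h) rfl
      exact ⟨W', hW'.trans inf_le_right, hrest⟩

end SmallSubrepresentations

section Correction

variable {Γ : Type*} [Group Γ]

/-- Extension of a unitary representation by a trivial one. -/
lemma exists_extension_by_trivial {k n : ℕ} (κ : Cn k →ₗᵢ[ℂ] Cn n)
    (ρ : Γ →* (Cn k →L[ℂ] Cn k)) (hρ : ∀ g v, ‖ρ g v‖ = ‖v‖) :
    ∃ σ : Γ →* (Cn n →L[ℂ] Cn n), (∀ g v, σ g (κ v) = κ (ρ g v)) ∧ ∀ g v, ‖σ g v‖ = ‖v‖ := by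
  let K := κ.toContinuousLinearMap
  have hKK : ∀ v, K.adjoint (κ v) = v := fun v => by
    refine ext_inner_right ℂ fun w => ?_
    rw [ContinuousLinearMap.adjoint_inner_left]
    exact κ.inner_map_map v w
  let s : Γ → (Cn n →L[ℂ] Cn n) := fun g => K ∘L ρ g ∘L K.adjoint + (1 - K ∘L K.adjoint)
  have hs : ∀ g v, s g v = κ (ρ g (K.adjoint v)) + (v - κ (K.adjoint v)) := fun g v => rfl
  have hKs : ∀ g v, K.adjoint (s g v) = ρ g (K.adjoint v) := fun g v => by
    simp [hs, map_add, map_sub, hKK]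
  let σ : Γ →* (Cn n →L[ℂ] Cn n) :=
    { toFun := s
      map_one' := by
        ext1 v
        rw [hs, map_one, one_apply_eq_self, one_apply_eq_self, add_sub_cancel]
      map_mul' := fun g h => by
        ext1 v
        rw [mul_apply_eq_comp, hs g (s h v), hKs, hs h v, hs, map_mul, mul_apply_eq_comp]
        abel }
  refine ⟨σ, fun g v => ?_, fun g v => ?_⟩
  · change s g (κ v) = _
    rw [hs, hKK, sub_self, add_zero]
  · change ‖s g v‖ = _
    have horth : ∀ u, ⟪κ u, v - κ (K.adjoint v)⟫_ℂ = 0 := fun u => by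
      have h : ⟪κ u, v⟫_ℂ = ⟪u, K.adjoint v⟫_ℂ :=
        (ContinuousLinearMap.adjoint_inner_right K u v).symm
      rw [inner_sub_right, κ.inner_map_map, h, sub_self]
    have h1 := norm_add_sq_eq_norm_sq_add_norm_sq_of_inner_eq_zero _ _
      (horth (ρ g (K.adjoint v)))
    have h2 := norm_add_sq_eq_norm_sq_add_norm_sq_of_inner_eq_zero _ _ (horth (K.adjoint v))
    rw [add_sub_cancel, κ.norm_map] at h2
    rw [← hs, κ.norm_map, hρ, ← h2] at h1
    exact (mul_self_inj (norm_nonneg _) (norm_nonneg _)).1 h1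

variable {H : Type*} [NormedAddCommGroup H] [InnerProductSpace ℂ H] [CompleteSpace H]

/-- A map which is almost intertwined with a unitary representation, and mostly concentrated on a
small subrepresentation, is close to a homomorphism. -/
theorem exists_representation_near {π : Γ →* (H →L[ℂ] H)} (hπ : ∀ g x, ‖π g x‖ = ‖x‖) {n : ℕ}
    {φ : Γ → Cn n →L[ℂ] Cn n} (hφ : ∀ g v, ‖φ g v‖ = ‖v‖) {V : Cn n →L[ℂ] H}
    (hV : ∀ v, ‖V v‖ = ‖v‖) {c d : ℝ} (hd : 0 ≤ d) (h : ∀ g, hs (π g ∘L V - V ∘L φ g) ≤ c)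
    (R : Submodule ℂ H) [FiniteDimensional ℂ R] (hR : ∀ g, ∀ v ∈ R, π g v ∈ R)
    (hRn : Module.finrank ℂ R ≤ n) (hRV : n - d ^ 2 ≤ hs (R.starProjection ∘L V) ^ 2) :
    ∃ σ : Γ →* (Cn n →L[ℂ] Cn n), (∀ g v, ‖σ g v‖ = ‖v‖) ∧ ∀ g, hs (φ g - σ g) ≤ 2 * d + c := by
  obtain ⟨ι, ρ, hι, hιρ, hρ⟩ := exists_subrepresentation hπ R hR
  obtain ⟨κ⟩ := exists_linearIsometry_of_le hRn
  obtain ⟨σ, hσκ, hσ⟩ := exists_extension_by_trivial κ ρ hρ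
  let I := ι.toContinuousLinearMap
  let K := κ.toContinuousLinearMap
  have hI : ∀ x, ‖I.adjoint x‖ ≤ ‖x‖ := adjoint_apply_norm_le I fun v => (ι.norm_map v).le
  have hIρ : ∀ g y, ρ g (I.adjoint y) = I.adjoint (π g y) := fun g y => by
    refine ext_inner_left ℂ fun w => ?_
    rw [ContinuousLinearMap.adjoint_inner_right, inner_map_right_of_isometric hπ,
      inner_map_right_of_isometric hρ, ContinuousLinearMap.adjoint_inner_right]
    exact congrArg (fun z => ⟪z, y⟫_ℂ) (hιρ g⁻¹ w)
  let X : Cn n →L[ℂ] Cn n := K ∘L I.adjoint ∘L V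
  have hX : ∀ v, ‖X v‖ ≤ ‖v‖ := fun v =>
    (κ.norm_map _).le.trans ((hI _).trans (hV v).le)
  have hXs : hs X = hs (R.starProjection ∘L V) := by
    have h1 := comp_adjoint_eq_starProjection ι
    simp only [hι] at h1
    rw [hs_comp_left_of_isometric K κ.norm_map, ← h1, ContinuousLinearMap.comp_assoc,
      hs_comp_left_of_isometric I ι.norm_map]
  obtain ⟨U, hU⟩ := exists_isometry_near_contraction X hX
  have hUX : hs (X - (U : Cn n →L[ℂ] Cn n)) ≤ d := by
    refine le_of_sq_le_sq (hU.trans ?_) hd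
    rw [hXs]
    linarith
  let τ : Γ →* (Cn n →L[ℂ] Cn n) :=
    { toFun := fun g => (U.symm : Cn n →L[ℂ] Cn n) ∘L σ g ∘L (U : Cn n →L[ℂ] Cn n)
      map_one' := by
        ext1 v
        simp
      map_mul' := fun g h => by
        ext1 v
        simp }
  refine ⟨τ, fun g v => ?_, fun g => ?_⟩
  · change ‖U.symm (σ g (U v))‖ = _
    rw [U.symm.norm_map, hσ, U.norm_map]
  · set u : Cn n →L[ℂ] Cn n := (U : Cn n →L[ℂ] Cn n)
    have h0 : hs (φ g - τ g) = hs (u ∘L φ g - σ g ∘L u) := by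
      rw [← hs_comp_left_of_isometric u U.norm_map]
      congr 1
      ext1 v
      change U (φ g v - U.symm (σ g (U v))) = U (φ g v) - σ g (U v)
      rw [map_sub, U.apply_symm_apply]
    have h1 : hs (u ∘L φ g - X ∘L φ g) ≤ d := by
      rw [← ContinuousLinearMap.sub_comp, hs_comp_right_of_isometric _ _ (hφ g), hs_sub_comm]
      exact hUX
    have h2 : hs (X ∘L φ g - σ g ∘L X) ≤ c := by
      rw [hs_sub_comm]
      have h3 : σ g ∘L X - X ∘L φ g = K ∘L I.adjoint ∘L (π g ∘L V - V ∘L φ g) := by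
        ext1 v
        change σ g (κ (I.adjoint (V v))) - κ (I.adjoint (V (φ g v))) =
          κ (I.adjoint (π g (V v) - V (φ g v)))
        rw [hσκ, hIρ, map_sub, map_sub]
      rw [h3, hs_comp_left_of_isometric K κ.norm_map]
      refine (hs_comp_left_le zero_le_one I.adjoint (fun v => ?_) _).trans ?_
      · rw [one_mul]
        exact hI v
      · rw [one_mul]
        exact h g
    have h4 : hs (σ g ∘L X - σ g ∘L u) ≤ d := by
      rw [← ContinuousLinearMap.comp_sub, hs_comp_left_of_isometric _ (hσ g)]
      exact hUX
    rw [h0]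
    linarith [hs_sub_le (u ∘L φ g) (X ∘L φ g) (σ g ∘L u),
      hs_sub_le (X ∘L φ g) (σ g ∘L X) (σ g ∘L u)]

/-- Shrinking a subspace loses at most the difference of the dimensions. -/
lemma hs_starProjection_comp_sq_le_add {n : ℕ} {W R : Submodule ℂ H} [FiniteDimensional ℂ W]
    [FiniteDimensional ℂ R] (hWR : W ≤ R) (V : Cn n →L[ℂ] H) (hV : ∀ v, ‖V v‖ ≤ ‖v‖) :
    hs (R.starProjection ∘L V) ^ 2 + Module.finrank ℂ W ≤
      hs (W.starProjection ∘L V) ^ 2 + Module.finrank ℂ R := by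
  have : FiniteDimensional ℂ (Wᗮ ⊓ R : Submodule ℂ H) :=
    Submodule.finiteDimensional_of_le inf_le_right
  have h1 := hs_starProjection_comp_sq_le (Wᗮ ⊓ R) V hV
  have hdim : (Module.finrank ℂ R : ℝ) =
      Module.finrank ℂ W + Module.finrank ℂ (Wᗮ ⊓ R : Submodule ℂ H) := by
    exact_mod_cast (Submodule.finrank_add_inf_finrank_orthogonal hWR).symm
  have hsplit : ∀ x, ‖R.starProjection x‖ ^ 2 =
      ‖W.starProjection x‖ ^ 2 + ‖(Wᗮ ⊓ R).starProjection x‖ ^ 2 := fun x => by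
    have hW : W.starProjection x ∈ W := Submodule.starProjection_apply_mem _ _
    have hx : x - R.starProjection x ∈ Rᗮ := R.sub_starProjection_mem_orthogonal x
    have hd : R.starProjection x - W.starProjection x ∈ Wᗮ := by
      have := Wᗮ.sub_mem (W.sub_starProjection_mem_orthogonal x)
        (Submodule.orthogonal_le hWR hx)
      simpa using this
    have hP : (Wᗮ ⊓ R).starProjection x = R.starProjection x - W.starProjection x := by
      refine Submodule.eq_starProjection_of_mem_orthogonal
        ⟨hd, R.sub_mem (Submodule.starProjection_apply_mem _ _) (hWR hW)⟩ ?_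
      rw [← sub_add]
      exact Submodule.add_mem _ (Submodule.orthogonal_le inf_le_right hx)
        (Submodule.orthogonal_le inf_le_left (W.le_orthogonal_orthogonal hW))
    have h := norm_add_sq_eq_norm_sq_add_norm_sq_of_inner_eq_zero (𝕜 := ℂ) _ _
      ((Submodule.mem_orthogonal _ _).1 hd _ hW)
    rw [hP, sq, sq, sq, ← h, add_sub_cancel]
  have h2 : hs (R.starProjection ∘L V) ^ 2 =
      hs (W.starProjection ∘L V) ^ 2 + hs ((Wᗮ ⊓ R).starProjection ∘L V) ^ 2 := by
    simp only [hs_sq, ContinuousLinearMap.comp_apply, hsplit, Finset.sum_add_distrib]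
  linarith

end Correction

/-- Finitely generated virtually abelian groups are uniformly stable. -/
theorem VirtuallyAbelian.opStable {Γ : Type*} [Group Γ] [Group.FG Γ] (h : VirtuallyAbelian Γ) :
    OpStable Γ := by
  obtain ⟨m, hm, hinv⟩ := h.exists_mean
  obtain ⟨A, hA, hcomm⟩ := h
  intro δ hδ
  have hd : (0 : ℝ) < 3 + 2 * A.index := by positivity
  obtain ⟨ε, hε, hε2, hεδ, hεd⟩ : ∃ ε : ℝ, 0 < ε ∧ ε ≤ 1 / 2 ∧ ε ≤ δ / 2 ∧
      (3 + 2 * A.index) * ε ≤ (δ / 4) ^ 2 := by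
    refine ⟨min (1 / 2) (min (δ / 2) ((δ / 4) ^ 2 / (3 + 2 * A.index))), by positivity,
      min_le_left _ _, (min_le_right _ _).trans (min_le_left _ _), ?_⟩
    rw [mul_comm, ← le_div_iff₀ hd]
    exact (min_le_right _ _).trans (min_le_right _ _)
  refine ⟨ε, hε, fun n φ hφ hφε => ?_⟩
  obtain ⟨H, _, _, _, π, V, hπ, hV, hπV⟩ := exists_dilation hm hinv φ hφ (by positivity) hφε
  obtain ⟨R, _, hR, hRn, hRV⟩ :=
    exists_invariant_subspace_near hm hinv hπ hV hε (by linarith) hπV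
  obtain ⟨W, _, hW, hWn, hWV⟩ : ∃ (W : Submodule ℂ H) (_ : FiniteDimensional ℂ W),
      (∀ g, ∀ v ∈ W, π g v ∈ W) ∧ Module.finrank ℂ W ≤ n ∧
        n - (3 + 2 * A.index) * ε * n ≤ hs (W.starProjection ∘L V) ^ 2 := by
    by_cases hdim : Module.finrank ℂ R ≤ n
    · refine ⟨R, inferInstance, hR, hdim, le_trans ?_ hRV⟩
      have : 0 ≤ (2 + 2 * A.index) * ε * n := by positivity
      linarith
    · obtain ⟨W, hWR, hW, hWf, hWn, hnW⟩ :=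
        exists_invariant_subspace_finrank A hcomm hπ n R hR (not_le.1 hdim)
      refine ⟨W, hWf, hW, hWn, ?_⟩
      have h1 := hs_starProjection_comp_sq_le_add hWR V fun v => (hV v).le
      have h2 : (n : ℝ) + 1 ≤ Module.finrank ℂ R := by exact_mod_cast not_le.1 hdim
      have h3 : (n : ℝ) ≤ Module.finrank ℂ W + A.index := by exact_mod_cast hnW.le
      have h4 : (Module.finrank ℂ R : ℝ) ≤ n + 2 * ε * n := by
        have h5 : (n : ℝ) ≤ (1 - ε) * (n + 2 * ε * n) := by
          have : 0 ≤ n * ε * (1 - 2 * ε) := by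
            have : 0 ≤ 1 - 2 * ε := by linarith
            positivity
          linarith
        exact le_of_mul_le_mul_left (hRn.trans h5) (by linarith)
      have h6 : (A.index : ℝ) * 1 ≤ A.index * (2 * ε * n) := by
        gcongr
        linarith
      linarith
  obtain ⟨σ, hσ, hφσ⟩ := exists_representation_near (d := δ / 4 * √n) hπ hφ hV (by positivity)
    hπV W hW hWn (by
      refine le_trans ?_ hWV
      rw [mul_pow, Real.sq_sqrt (Nat.cast_nonneg n)]
      gcongr)
  refine ⟨σ, hσ, fun g => (hφσ g).trans ?_⟩
  have : ε * √n ≤ δ / 2 * √n := by gcongr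
  linarith

end

/-- A finitely generated residually finite group is uniformly HS stable
if and only if it is virtually abelian. -/
theorem stmt_0 (Γ : Type*) [Group Γ] (hfg : Group.FG Γ) (hrf : ResiduallyFinite Γ) :
    UniformlyHSStable Γ ↔ VirtuallyAbelian Γ :=
  (uniformlyHSStable_iff_opStable Γ).trans ⟨fun h => h.virtuallyAbelian hrf, fun h => h.opStable⟩
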